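/- For all x ∈ A, writing Δ^{(3)}(Ω) = Ω_{(1)} ⊗ Ω_{(2)} ⊗ Ω_{(3)} ⊗ Ω_{(4)} and Δ(x) = x_{(1)} ⊗ x_{(2)}, the following identity holds in A^{⊗4}: x_{(1)} ξ_L^{1/2} J(Ω_{(2)}) ⊗ x_{(2)} ξ_R^{1/2} J(Ω_{(1)}) ⊗ Ω_{(3)} ⊗ Ω_{(4)} = ξ_L^{1/2} J(Ω_{(2)}) ⊗ ξ_R^{1/2} J(Ω_{(1)}) ⊗ Ω_{(3)} x_{(1)} ⊗ Ω_{(4)} x_{(2)}. -/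

import Mathlib

open scoped TensorProduct

noncomputable section

/-- An element of a `C*`-algebra is positive iff it is of the form `star y * y`. -/
def IsPosElem {A : Type*} [Mul A] [Star A] (x : A) : Prop := ∃ y : A, x = star y * y

section Helpers

variable {A : Type*} [NormedRing A] [StarRing A] [CStarRing A]
  [NormedAlgebra ℂ A] [StarModule ℂ A]

/-- Apply a linear functional to the first leg of a tensor (`⟨φ, u₁⟩ u₂`). -/
def lapp (φ : A →ₗ[ℂ] ℂ) : A ⊗[ℂ] A →ₗ[ℂ] A :=
  (TensorProduct.lid ℂ A).toLinearMap ∘ₗ TensorProduct.map φ LinearMap.id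

/-- Apply a linear functional to the second leg of a tensor (`⟨φ, u₂⟩ u₁`). -/
def rapp (φ : A →ₗ[ℂ] ℂ) : A ⊗[ℂ] A →ₗ[ℂ] A :=
  (TensorProduct.rid ℂ A).toLinearMap ∘ₗ TensorProduct.map LinearMap.id φ

/-- Apply a pair of linear functionals to the two legs of a tensor (`⟨φ, u₁⟩⟨ψ, u₂⟩`). -/
def papp (φ ψ : A →ₗ[ℂ] ℂ) : A ⊗[ℂ] A →ₗ[ℂ] ℂ :=
  (TensorProduct.lid ℂ ℂ).toLinearMap ∘ₗ TensorProduct.map φ ψ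

end Helpers

/-- A `C*`-weak Hopf algebra: a finite-dimensional unital `C*`-algebra `A` equipped with a
comultiplication `Δ` (written in Sweedler notation `Δ x = x₍₁₎ ⊗ x₍₂₎`), counit `ε` and
antipode `S`, satisfying the axioms of Böhm–Szlachányi.  The field `starT` is the
(componentwise) star operation on `A ⊗[ℂ] A`, characterized by additivity and its values on
pure tensors. -/
structure WeakHopfData (A : Type*) [NormedRing A] [StarRing A] [CStarRing A]
    [NormedAlgebra ℂ A] [StarModule ℂ A] [FiniteDimensional ℂ A] : Type _ where
  Δ : A →ₗ[ℂ] A ⊗[ℂ] A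
  ε : A →ₗ[ℂ] ℂ
  S : A ≃ₗ[ℂ] A
  starT : A ⊗[ℂ] A → A ⊗[ℂ] A
  starT_add : ∀ u v : A ⊗[ℂ] A, starT (u + v) = starT u + starT v
  starT_tmul : ∀ a b : A, starT (a ⊗ₜ[ℂ] b) = star a ⊗ₜ[ℂ] star b
  /-- coassociativity of the comultiplication -/
  coassoc : (TensorProduct.assoc ℂ A A A).toLinearMap ∘ₗ
      (TensorProduct.map Δ LinearMap.id) ∘ₗ Δ = (TensorProduct.map LinearMap.id Δ) ∘ₗ Δ
  /-- counit axiom, left version -/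
  counit_left : (TensorProduct.lid ℂ A).toLinearMap ∘ₗ (TensorProduct.map ε LinearMap.id) ∘ₗ Δ
      = LinearMap.id
  /-- counit axiom, right version -/
  counit_right : (TensorProduct.rid ℂ A).toLinearMap ∘ₗ (TensorProduct.map LinearMap.id ε) ∘ₗ Δ
      = LinearMap.id
  /-- the comultiplication is multiplicative -/
  Δ_mul : ∀ x y : A, Δ (x * y) = Δ x * Δ y
  /-- the star operation is comultiplicative -/
  Δ_star : ∀ x : A, Δ (star x) = starT (Δ x)
  /-- the unit is weakly comultiplicative:
  `(Δ ⊗ id)(Δ 1) = (Δ 1 ⊗ 1)(1 ⊗ Δ 1)` -/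
  Δ_one_weak : (TensorProduct.map Δ LinearMap.id) (Δ 1)
      = (Δ 1 ⊗ₜ[ℂ] (1 : A)) * ((TensorProduct.assoc ℂ A A A).symm ((1 : A) ⊗ₜ[ℂ] Δ 1))
  /-- the unit is weakly comultiplicative:
  `(Δ ⊗ id)(Δ 1) = (1 ⊗ Δ 1)(Δ 1 ⊗ 1)` -/
  Δ_one_weak' : (TensorProduct.map Δ LinearMap.id) (Δ 1)
      = ((TensorProduct.assoc ℂ A A A).symm ((1 : A) ⊗ₜ[ℂ] Δ 1)) * (Δ 1 ⊗ₜ[ℂ] (1 : A))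
  /-- the counit is weakly multiplicative: `ε (x y z) = ε (x y₍₁₎) ε (y₍₂₎ z)` -/
  ε_weak : ∀ x y z : A,
      ε (x * y * z) = papp (ε ∘ₗ LinearMap.mulLeft ℂ x) (ε ∘ₗ LinearMap.mulRight ℂ z) (Δ y)
  /-- the counit is weakly multiplicative: `ε (x y z) = ε (x y₍₂₎) ε (y₍₁₎ z)` -/
  ε_weak' : ∀ x y z : A,
      ε (x * y * z) = papp (ε ∘ₗ LinearMap.mulRight ℂ z) (ε ∘ₗ LinearMap.mulLeft ℂ x) (Δ y)
  /-- antipode axiom: `x₍₁₎ S(x₍₂₎) = ε (1₍₁₎ x) 1₍₂₎` -/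
  antipode_left : ∀ x : A,
      LinearMap.mul' ℂ A ((TensorProduct.map LinearMap.id S.toLinearMap) (Δ x))
        = lapp (ε ∘ₗ LinearMap.mulRight ℂ x) (Δ 1)
  /-- antipode axiom: `S(x₍₁₎) x₍₂₎ = 1₍₁₎ ε (x 1₍₂₎)` -/
  antipode_right : ∀ x : A,
      LinearMap.mul' ℂ A ((TensorProduct.map S.toLinearMap LinearMap.id) (Δ x))
        = rapp (ε ∘ₗ LinearMap.mulLeft ℂ x) (Δ 1)
  /-- the antipode is antimultiplicative -/
  S_antimul : ∀ x y : A, S (x * y) = S y * S x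
  /-- the antipode is anticomultiplicative -/
  S_anticomul : ∀ x : A,
      Δ (S x) = (TensorProduct.comm ℂ A A) ((TensorProduct.map S.toLinearMap S.toLinearMap) (Δ x))

namespace WeakHopfData

variable {A : Type*} [NormedRing A] [StarRing A] [CStarRing A]
  [NormedAlgebra ℂ A] [StarModule ℂ A] [FiniteDimensional ℂ A]

/-- The source counital map `ε^L (x) = x₍₁₎ S(x₍₂₎)`. -/
def εL (W : WeakHopfData A) : A →ₗ[ℂ] A :=
  LinearMap.mul' ℂ A ∘ₗ TensorProduct.map LinearMap.id W.S.toLinearMap ∘ₗ W.Δ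

/-- The target counital map `ε^R (x) = S(x₍₁₎) x₍₂₎`. -/
def εR (W : WeakHopfData A) : A →ₗ[ℂ] A :=
  LinearMap.mul' ℂ A ∘ₗ TensorProduct.map W.S.toLinearMap LinearMap.id ∘ₗ W.Δ

/-- Full contraction of the iterated coproduct `Δ⁽ⁿ⁾ x = x₍₁₎ ⊗ ⋯ ⊗ x₍ₙ₊₁₎` against a family
of `n+1` linear functionals: `sweedlerEval W n φ x = ⟨φ 0, x₍₁₎⟩ ⋯ ⟨φ n, x₍ₙ₊₁₎⟩`.
Since linear functionals separate the points of a tensor power, identities between iterated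
coproducts are faithfully expressed through these contractions. -/
def sweedlerEval (W : WeakHopfData A) : (n : ℕ) → (Fin (n + 1) → (A →ₗ[ℂ] ℂ)) → (A →ₗ[ℂ] ℂ)
  | 0, φ => φ 0
  | n + 1, φ => papp (sweedlerEval W n (Fin.init φ)) (φ (Fin.last (n + 1))) ∘ₗ W.Δ

end WeakHopfData

/-- A `C*`-weak Hopf algebra together with its canonical distinguished elements:
the Haar integral `h`, the dual Haar integral `hHat`, the square roots `gL`, `gR` of
`E^L h`, `E^R h` (whence the canonical grouplike element `g = gL * gR⁻¹`), real powers
`gLpow`, `gRpow` of `gL` and `gR`, and a positive square root operation `sqrt`;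
all characterized by the (uniquely determining) properties listed as fields. -/
structure HaarPkg (A : Type*) [NormedRing A] [StarRing A] [CStarRing A]
    [NormedAlgebra ℂ A] [StarModule ℂ A] [FiniteDimensional ℂ A] : Type _ where
  W : WeakHopfData A
  /-- the Haar integral -/
  h : A
  haar_left : ∀ x : A, x * h = WeakHopfData.εL W x * h
  haar_right : ∀ x : A, h * x = h * WeakHopfData.εR W x
  haar_counitL : WeakHopfData.εL W h = 1
  haar_counitR : WeakHopfData.εR W h = 1
  haar_idem : h * h = h
  haar_star : star h = h
  haar_S : W.S h = h
  haar_nondeg : ∀ y : A, ∃ φ ψ : A →ₗ[ℂ] ℂ, lapp φ (W.Δ h) = y ∧ rapp ψ (W.Δ h) = y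
  /-- the Haar integral of the dual weak Hopf algebra `A*`, as a linear functional on `A` -/
  hHat : A →ₗ[ℂ] ℂ
  hHat_pos : ∀ x : A, ∃ r : ℝ, 0 ≤ r ∧ hHat (star x * x) = (r : ℂ)
  hHat_S : ∀ x : A, hHat (W.S x) = hHat x
  /-- `gL = (E^L h)^{1/2}` -/
  gL : A
  /-- `gR = (E^R h)^{1/2}` -/
  gR : A
  gL_pos : IsPosElem gL
  gR_pos : IsPosElem gR
  gL_unit : IsUnit gL
  gR_unit : IsUnit gR
  gL_sq : gL * gL = rapp hHat (W.Δ h)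
  gR_sq : gR * gR = lapp hHat (W.Δ h)
  gL_mem : gL ∈ Set.range (WeakHopfData.εL W)
  gR_mem : gR ∈ Set.range (WeakHopfData.εR W)
  gR_S : gR = W.S gL
  gLR_comm : gL * gR = gR * gL
  /-- the canonical grouplike element `g = gL * gR⁻¹` is positive -/
  g_pos : IsPosElem (gL * Ring.inverse gR)
  g_unit : IsUnit (gL * Ring.inverse gR)
  /-- `Δ g = (g ⊗ g) Δ 1` -/
  g_grouplike : W.Δ (gL * Ring.inverse gR)
      = ((gL * Ring.inverse gR) ⊗ₜ[ℂ] (gL * Ring.inverse gR)) * W.Δ 1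
  /-- `Δ g = Δ 1 (g ⊗ g)` -/
  g_grouplike' : W.Δ (gL * Ring.inverse gR)
      = W.Δ 1 * ((gL * Ring.inverse gR) ⊗ₜ[ℂ] (gL * Ring.inverse gR))
  /-- `S g = g⁻¹` -/
  g_S : W.S (gL * Ring.inverse gR) = Ring.inverse (gL * Ring.inverse gR)
  /-- `S² x = g x g⁻¹` -/
  S_sq : ∀ x : A,
      W.S (W.S x) = (gL * Ring.inverse gR) * x * Ring.inverse (gL * Ring.inverse gR)
  /-- `h₍₁₎ ⊗ g h₍₂₎ g = h₍₂₎ ⊗ h₍₁₎` -/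
  haar_flip : TensorProduct.map LinearMap.id
      (LinearMap.mulLeft ℂ (gL * Ring.inverse gR) ∘ₗ LinearMap.mulRight ℂ (gL * Ring.inverse gR))
      (W.Δ h) = (TensorProduct.comm ℂ A A) (W.Δ h)
  /-- dual integral relation `⟨ĥ, x (h gL⁻²)⟩ = ε x` -/
  hHat_dual₁ : ∀ x : A, hHat (x * (h * (Ring.inverse gL * Ring.inverse gL))) = W.ε x
  /-- dual integral relation `⟨ĥ, (gR⁻² h) x⟩ = ε x` -/
  hHat_dual₂ : ∀ x : A, hHat ((Ring.inverse gR * Ring.inverse gR * h) * x) = W.ε x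
  /-- dual integral relation `⟨ĥ, (h gL⁻²)₍₂₎⟩ (h gL⁻²)₍₁₎ = 1` -/
  hHat_dual₃ : rapp hHat (W.Δ (h * (Ring.inverse gL * Ring.inverse gL))) = 1
  /-- dual integral relation `⟨ĥ, (gR⁻² h)₍₁₎⟩ (gR⁻² h)₍₂₎ = 1` -/
  hHat_dual₄ : lapp hHat (W.Δ (Ring.inverse gR * Ring.inverse gR * h)) = 1
  /-- the positive square root, via the continuous functional calculus -/
  sqrt : A → A
  sqrt_pos : ∀ x : A, IsPosElem x → IsPosElem (sqrt x)
  sqrt_mul_self : ∀ x : A, IsPosElem x → sqrt x * sqrt x = x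
  /-- real powers of `gL`, via the continuous functional calculus -/
  gLpow : ℝ → A
  /-- real powers of `gR`, via the continuous functional calculus -/
  gRpow : ℝ → A
  gLpow_one : gLpow 1 = gL
  gRpow_one : gRpow 1 = gR
  gLpow_zero : gLpow 0 = 1
  gRpow_zero : gRpow 0 = 1
  gLpow_add : ∀ s t : ℝ, gLpow (s + t) = gLpow s * gLpow t
  gRpow_add : ∀ s t : ℝ, gRpow (s + t) = gRpow s * gRpow t
  gLpow_pos : ∀ t : ℝ, IsPosElem (gLpow t)
  gRpow_pos : ∀ t : ℝ, IsPosElem (gRpow t)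
  gLpow_continuous : Continuous gLpow
  gRpow_continuous : Continuous gRpow

namespace HaarPkg

variable {A : Type*} [NormedRing A] [StarRing A] [CStarRing A]
  [NormedAlgebra ℂ A] [StarModule ℂ A] [FiniteDimensional ℂ A]
variable (P : HaarPkg A)

/-- The canonical grouplike element `g = gL gR⁻¹`. -/
def g : A := P.gL * Ring.inverse P.gR

/-- The Watatani index `ı = ε^L (h gL⁻²)` of the Haar conditional expectations. -/
def iotaEl : A := WeakHopfData.εL P.W (P.h * (Ring.inverse P.gL * Ring.inverse P.gL))

/-- The element `ȷ = ⟨ĥ, (gL⁻²)₍₁₎⟩ (gL⁻²)₍₂₎`, the dual analogue of the Watatani index. -/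
def jayEl : A := lapp P.hHat (P.W.Δ (Ring.inverse P.gL * Ring.inverse P.gL))

/-- The pulling-through element `Ω = ı⁻¹ gL⁻¹ h gL⁻¹`. -/
def Ω : A := Ring.inverse P.iotaEl * Ring.inverse P.gL * P.h * Ring.inverse P.gL

/-- The map `J x = g^{-1/2} S(x) g^{1/2}`, as a linear map. -/
def Jlin : A →ₗ[ℂ] A :=
  LinearMap.mulRight ℂ (P.sqrt P.g) ∘ₗ
    LinearMap.mulLeft ℂ (Ring.inverse (P.sqrt P.g)) ∘ₗ P.W.S.toLinearMap

/-- The functional `⟨ω, x⟩ = ⟨ĥ, ȷ⁻¹ gL⁻¹ gR⁻¹ x⟩` (the dual analogue of `Ω`). -/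
def ω : A →ₗ[ℂ] ℂ :=
  P.hHat ∘ₗ LinearMap.mulLeft ℂ (Ring.inverse P.jayEl * (Ring.inverse P.gL * Ring.inverse P.gR))

/-- `ξ_L = ı^{1/2} ȷ^{1/2} gL`. -/
def ξL : A := P.sqrt P.iotaEl * P.sqrt P.jayEl * P.gL

/-- `ξ_R = ı^{1/2} ȷ^{1/2} gR`. -/
def ξR : A := P.sqrt P.iotaEl * P.sqrt P.jayEl * P.gR

/-- `ξ = ξ_L ξ_R`. -/
def ξ : A := P.ξL * P.ξR

/-- `J^L x = gL⁻¹ S(x) gL`. -/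
def JL : A → A := fun x => Ring.inverse P.gL * P.W.S x * P.gL

/-- `J^R x = gL S⁻¹(x) gL⁻¹`. -/
def JR : A → A := fun x => P.gL * P.W.S.symm x * Ring.inverse P.gL

end HaarPkg

section Stmt19

variable {A : Type*} [NormedRing A] [StarRing A] [CStarRing A]
  [NormedAlgebra ℂ A] [StarModule ℂ A] [FiniteDimensional ℂ A]

/-- The iterated coproduct `Δ⁽²⁾ : A → A^{⊗3}`. -/
noncomputable def WeakHopfData.Δ2 (W : WeakHopfData A) :
    A →ₗ[ℂ] (A ⊗[ℂ] A) ⊗[ℂ] A :=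
  TensorProduct.map W.Δ LinearMap.id ∘ₗ W.Δ

/-- The iterated coproduct `Δ⁽³⁾ : A → A^{⊗4}`. -/
noncomputable def WeakHopfData.Δ3 (W : WeakHopfData A) :
    A →ₗ[ℂ] ((A ⊗[ℂ] A) ⊗[ℂ] A) ⊗[ℂ] A :=
  TensorProduct.map W.Δ2 LinearMap.id ∘ₗ W.Δ

/-- The element `ξ_L^{1/2} J(Ω₍₂₎) ⊗ ξ_R^{1/2} J(Ω₍₁₎) ⊗ Ω₍₃₎ ⊗ Ω₍₄₎` of `A^{⊗4}`. -/
noncomputable def HaarPkg.fourLegTensor (P : HaarPkg A) :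
    ((A ⊗[ℂ] A) ⊗[ℂ] A) ⊗[ℂ] A :=
  TensorProduct.map (TensorProduct.map
      ((TensorProduct.map (LinearMap.mulLeft ℂ (P.sqrt P.ξL) ∘ₗ P.Jlin)
          (LinearMap.mulLeft ℂ (P.sqrt P.ξR) ∘ₗ P.Jlin)) ∘ₗ
        (TensorProduct.comm ℂ A A).toLinearMap)
      LinearMap.id) LinearMap.id (P.W.Δ3 P.Ω)

/-- The embedding `u ⊗ v ↦ u ⊗ v ⊗ 1 ⊗ 1` of `A^{⊗2}` into `A^{⊗4}`. -/
noncomputable def firstTwoLegs : A ⊗[ℂ] A →ₗ[ℂ] ((A ⊗[ℂ] A) ⊗[ℂ] A) ⊗[ℂ] A :=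
  (TensorProduct.mk ℂ ((A ⊗[ℂ] A) ⊗[ℂ] A) A).flip 1 ∘ₗ
    (TensorProduct.mk ℂ (A ⊗[ℂ] A) A).flip 1

/-- The embedding `u ⊗ v ↦ 1 ⊗ 1 ⊗ u ⊗ v` of `A^{⊗2}` into `A^{⊗4}`. -/
noncomputable def lastTwoLegs : A ⊗[ℂ] A →ₗ[ℂ] ((A ⊗[ℂ] A) ⊗[ℂ] A) ⊗[ℂ] A :=
  TensorProduct.map (TensorProduct.mk ℂ (A ⊗[ℂ] A) A ((1 : A) ⊗ₜ[ℂ] (1 : A))) LinearMap.id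

section Tensor

variable {B : Type*} [NormedRing B] [NormedAlgebra ℂ B]

lemma lapp_tmul (φ : B →ₗ[ℂ] ℂ) (a b : B) : lapp φ (a ⊗ₜ[ℂ] b) = φ a • b := by
  simp [lapp]

lemma rapp_tmul (φ : B →ₗ[ℂ] ℂ) (a b : B) : rapp φ (a ⊗ₜ[ℂ] b) = φ b • a := by
  simp [rapp]

lemma lapp_mul_one_tmul (φ : B →ₗ[ℂ] ℂ) (t : B ⊗[ℂ] B) (x : B) :
    lapp φ (t * (1 : B) ⊗ₜ[ℂ] x) = lapp φ t * x := by
  induction t with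
  | zero => simp
  | add s t hs ht => simp [add_mul, hs, ht]
  | tmul a b => simp [lapp_tmul]

lemma lapp_one_tmul_mul (φ : B →ₗ[ℂ] ℂ) (t : B ⊗[ℂ] B) (x : B) :
    lapp φ ((1 : B) ⊗ₜ[ℂ] x * t) = x * lapp φ t := by
  induction t with
  | zero => simp
  | add s t hs ht => simp [mul_add, hs, ht]
  | tmul a b => simp [lapp_tmul]

lemma lapp_mul_tmul_one (φ : B →ₗ[ℂ] ℂ) (t : B ⊗[ℂ] B) (x : B) :
    lapp φ (t * x ⊗ₜ[ℂ] (1 : B)) = lapp (φ ∘ₗ LinearMap.mulRight ℂ x) t := by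
  induction t with
  | zero => simp
  | add s t hs ht => simp [add_mul, hs, ht]
  | tmul a b => simp [lapp_tmul]

lemma rapp_tmul_one_mul (φ : B →ₗ[ℂ] ℂ) (t : B ⊗[ℂ] B) (x : B) :
    rapp φ (x ⊗ₜ[ℂ] (1 : B) * t) = x * rapp φ t := by
  induction t with
  | zero => simp
  | add s t hs ht => simp [mul_add, hs, ht]
  | tmul a b => simp [rapp_tmul]

lemma rapp_one_tmul_mul (φ : B →ₗ[ℂ] ℂ) (t : B ⊗[ℂ] B) (x : B) :
    rapp φ ((1 : B) ⊗ₜ[ℂ] x * t) = rapp (φ ∘ₗ LinearMap.mulLeft ℂ x) t := by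
  induction t with
  | zero => simp
  | add s t hs ht => simp [mul_add, hs, ht]
  | tmul a b => simp [rapp_tmul]

lemma rapp_mul_one_tmul (φ : B →ₗ[ℂ] ℂ) (t : B ⊗[ℂ] B) (x : B) :
    rapp φ (t * (1 : B) ⊗ₜ[ℂ] x) = rapp (φ ∘ₗ LinearMap.mulRight ℂ x) t := by
  induction t with
  | zero => simp
  | add s t hs ht => simp [add_mul, hs, ht]
  | tmul a b => simp [rapp_tmul]

lemma lapp_map_id (φ : B →ₗ[ℂ] ℂ) (f : B →ₗ[ℂ] B) (t : B ⊗[ℂ] B) :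
    lapp φ (TensorProduct.map f LinearMap.id t) = lapp (φ ∘ₗ f) t := by
  induction t with
  | zero => simp
  | add s t hs ht => simp [hs, ht]
  | tmul a b => simp [lapp_tmul]

lemma rapp_map_id (φ : B →ₗ[ℂ] ℂ) (f : B →ₗ[ℂ] B) (t : B ⊗[ℂ] B) :
    rapp φ (TensorProduct.map LinearMap.id f t) = rapp (φ ∘ₗ f) t := by
  induction t with
  | zero => simp
  | add s t hs ht => simp [hs, ht]
  | tmul a b => simp [rapp_tmul]

lemma tensorAssoc_mul (s t : (B ⊗[ℂ] B) ⊗[ℂ] B) :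
    TensorProduct.assoc ℂ B B B (s * t)
      = TensorProduct.assoc ℂ B B B s * TensorProduct.assoc ℂ B B B t :=
  map_mul (Algebra.TensorProduct.assoc ℂ ℂ ℂ B B B) s t

/-- Apply a linear functional to the first leg of a three-fold tensor. -/
def lappThree (φ : B →ₗ[ℂ] ℂ) : B ⊗[ℂ] (B ⊗[ℂ] B) →ₗ[ℂ] B ⊗[ℂ] B :=
  (TensorProduct.lid ℂ (B ⊗[ℂ] B)).toLinearMap ∘ₗ TensorProduct.map φ LinearMap.id

/-- Apply a linear functional to the last leg of a three-fold tensor. -/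
def rappThree (φ : B →ₗ[ℂ] ℂ) : (B ⊗[ℂ] B) ⊗[ℂ] B →ₗ[ℂ] B ⊗[ℂ] B :=
  (TensorProduct.rid ℂ (B ⊗[ℂ] B)).toLinearMap ∘ₗ TensorProduct.map LinearMap.id φ

lemma lappThree_assoc_mul (φ : B →ₗ[ℂ] ℂ) (s w : B ⊗[ℂ] B) :
    lappThree φ (TensorProduct.assoc ℂ B B B (s ⊗ₜ[ℂ] (1 : B)) * (1 : B) ⊗ₜ[ℂ] w)
      = lapp φ s ⊗ₜ[ℂ] (1 : B) * w := by
  induction s with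
  | zero => simp
  | add s t hs ht => simp only [add_mul, TensorProduct.add_tmul, map_add, hs, ht]
  | tmul a b => simp [lapp_tmul, lappThree, TensorProduct.smul_tmul', ← smul_mul_assoc]

lemma lappThree_mul_assoc (φ : B →ₗ[ℂ] ℂ) (s w : B ⊗[ℂ] B) :
    lappThree φ ((1 : B) ⊗ₜ[ℂ] w * TensorProduct.assoc ℂ B B B (s ⊗ₜ[ℂ] (1 : B)))
      = w * lapp φ s ⊗ₜ[ℂ] (1 : B) := by
  induction s with
  | zero => simp
  | add s t hs ht => simp only [mul_add, TensorProduct.add_tmul, map_add, hs, ht]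
  | tmul a b => simp [lapp_tmul, lappThree, ← TensorProduct.smul_tmul']

lemma rappThree_mul_assoc_symm (φ : B →ₗ[ℂ] ℂ) (s w : B ⊗[ℂ] B) :
    rappThree φ (w ⊗ₜ[ℂ] (1 : B) * (TensorProduct.assoc ℂ B B B).symm ((1 : B) ⊗ₜ[ℂ] s))
      = w * (1 : B) ⊗ₜ[ℂ] rapp φ s := by
  induction s with
  | zero => simp
  | add s t hs ht => simp only [mul_add, TensorProduct.tmul_add, map_add, hs, ht]
  | tmul a b => simp [rapp_tmul, rappThree]

lemma rappThree_assoc_symm_mul (φ : B →ₗ[ℂ] ℂ) (s w : B ⊗[ℂ] B) :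
    rappThree φ ((TensorProduct.assoc ℂ B B B).symm ((1 : B) ⊗ₜ[ℂ] s) * w ⊗ₜ[ℂ] (1 : B))
      = (1 : B) ⊗ₜ[ℂ] rapp φ s * w := by
  induction s with
  | zero => simp
  | add s t hs ht => simp only [add_mul, TensorProduct.tmul_add, map_add, hs, ht]
  | tmul a b => simp [rapp_tmul, rappThree]

end Tensor

namespace WeakHopfData

variable (W : WeakHopfData A)

lemma coassoc_apply (x : A) : TensorProduct.assoc ℂ A A A
    (TensorProduct.map W.Δ LinearMap.id (W.Δ x)) = TensorProduct.map LinearMap.id W.Δ (W.Δ x) :=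
  LinearMap.congr_fun W.coassoc x

lemma lapp_counit (x : A) : lapp W.ε (W.Δ x) = x := LinearMap.congr_fun W.counit_left x

lemma rapp_counit (x : A) : rapp W.ε (W.Δ x) = x := LinearMap.congr_fun W.counit_right x

lemma Δ_one_mul (x : A) : W.Δ 1 * W.Δ x = W.Δ x := by rw [← W.Δ_mul, one_mul]

lemma Δ_mul_one (x : A) : W.Δ x * W.Δ 1 = W.Δ x := by rw [← W.Δ_mul, mul_one]

lemma S_one : W.S 1 = 1 := by
  obtain ⟨y, hy⟩ := W.S.surjective 1
  have h := W.S_antimul y 1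
  rw [mul_one, hy, mul_one] at h
  exact h.symm

lemma εL_apply (x : A) : W.εL x = lapp (W.ε ∘ₗ LinearMap.mulRight ℂ x) (W.Δ 1) :=
  W.antipode_left x

lemma εR_apply (x : A) : W.εR x = rapp (W.ε ∘ₗ LinearMap.mulLeft ℂ x) (W.Δ 1) :=
  W.antipode_right x

lemma map_id_Δ_one : TensorProduct.map LinearMap.id W.Δ (W.Δ 1)
    = TensorProduct.assoc ℂ A A A (W.Δ 1 ⊗ₜ[ℂ] (1 : A)) * (1 : A) ⊗ₜ[ℂ] W.Δ 1 := by
  rw [← coassoc_apply, Δ_one_weak, tensorAssoc_mul, LinearEquiv.apply_symm_apply]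

lemma map_id_Δ_one' : TensorProduct.map LinearMap.id W.Δ (W.Δ 1)
    = (1 : A) ⊗ₜ[ℂ] W.Δ 1 * TensorProduct.assoc ℂ A A A (W.Δ 1 ⊗ₜ[ℂ] (1 : A)) := by
  rw [← coassoc_apply, Δ_one_weak', tensorAssoc_mul, LinearEquiv.apply_symm_apply]

/-- The elements whose coproduct is given by multiplying the first leg of `Δ 1`. -/
def IsLeft (a : A) : Prop :=
  W.Δ a = a ⊗ₜ[ℂ] (1 : A) * W.Δ 1 ∧ W.Δ a = W.Δ 1 * a ⊗ₜ[ℂ] (1 : A)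

/-- The elements whose coproduct is given by multiplying the second leg of `Δ 1`. -/
def IsRight (a : A) : Prop :=
  W.Δ a = (1 : A) ⊗ₜ[ℂ] a * W.Δ 1 ∧ W.Δ a = W.Δ 1 * (1 : A) ⊗ₜ[ℂ] a

lemma Δ_lapp (φ : A →ₗ[ℂ] ℂ) (t : A ⊗[ℂ] A) :
    W.Δ (lapp φ t) = lappThree φ (TensorProduct.map LinearMap.id W.Δ t) := by
  induction t with
  | zero => simp
  | add s t hs ht => simp [hs, ht]
  | tmul a b => simp [lapp_tmul, lappThree]

lemma Δ_rapp (φ : A →ₗ[ℂ] ℂ) (t : A ⊗[ℂ] A) :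
    W.Δ (rapp φ t) = rappThree φ (TensorProduct.map W.Δ LinearMap.id t) := by
  induction t with
  | zero => simp
  | add s t hs ht => simp [hs, ht]
  | tmul a b => simp [rapp_tmul, rappThree]

lemma isLeft_lapp (φ : A →ₗ[ℂ] ℂ) : W.IsLeft (lapp φ (W.Δ 1)) := by
  constructor
  · rw [Δ_lapp, map_id_Δ_one, lappThree_assoc_mul]
  · rw [Δ_lapp, map_id_Δ_one', lappThree_mul_assoc]

lemma isRight_rapp (φ : A →ₗ[ℂ] ℂ) : W.IsRight (rapp φ (W.Δ 1)) := by
  constructor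
  · rw [Δ_rapp, Δ_one_weak', rappThree_assoc_symm_mul]
  · rw [Δ_rapp, Δ_one_weak, rappThree_mul_assoc_symm]

lemma isLeft_εL (x : A) : W.IsLeft (W.εL x) := by
  rw [εL_apply]; exact W.isLeft_lapp _

lemma isRight_εR (x : A) : W.IsRight (W.εR x) := by
  rw [εR_apply]; exact W.isRight_rapp _

variable {W} in
lemma IsLeft.mul {a b : A} (ha : W.IsLeft a) (hb : W.IsLeft b) : W.IsLeft (a * b) := by
  have e : (a * b) ⊗ₜ[ℂ] (1 : A) = a ⊗ₜ[ℂ] (1 : A) * b ⊗ₜ[ℂ] (1 : A) := by simp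
  constructor
  · rw [W.Δ_mul, ha.1, mul_assoc, Δ_one_mul, hb.1, e, mul_assoc]
  · rw [W.Δ_mul, hb.2, ← mul_assoc, Δ_mul_one, ha.2, e, mul_assoc]

variable {W} in
lemma IsLeft.inverse {a : A} (ha : W.IsLeft a) : W.IsLeft (Ring.inverse a) := by
  by_cases hu : IsUnit a
  · obtain ⟨u, rfl⟩ := hu
    rw [Ring.inverse_unit]
    have e : (↑u⁻¹ : A) ⊗ₜ[ℂ] (1 : A) * (u : A) ⊗ₜ[ℂ] (1 : A) = 1 := by
      simp [Algebra.TensorProduct.one_def]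
    have e' : (u : A) ⊗ₜ[ℂ] (1 : A) * (↑u⁻¹ : A) ⊗ₜ[ℂ] (1 : A) = 1 := by
      simp [Algebra.TensorProduct.one_def]
    constructor
    · have h := W.Δ_mul u ↑u⁻¹
      rw [Units.mul_inv, ha.1, mul_assoc, Δ_one_mul] at h
      rw [h, ← mul_assoc, e, one_mul]
    · have h := W.Δ_mul ↑u⁻¹ u
      rw [Units.inv_mul, ha.2, ← mul_assoc, Δ_mul_one] at h
      rw [h, mul_assoc, e', mul_one]
  · rw [Ring.inverse_non_unit _ hu]
    constructor <;> simp

variable {W} in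
lemma IsLeft.aeval {a : A} (ha : W.IsLeft a) (p : Polynomial ℝ) :
    W.IsLeft (Polynomial.aeval a p) := by
  induction p using Polynomial.induction_on' with
  | add p q hp hq =>
    rw [map_add]
    constructor
    · rw [map_add, hp.1, hq.1, TensorProduct.add_tmul, add_mul]
    · rw [map_add, hp.2, hq.2, TensorProduct.add_tmul, mul_add]
  | monomial n r =>
    have hpow : W.IsLeft (a ^ n) := by
      induction n with
      | zero =>
        rw [pow_zero]
        constructor
        · rw [← Algebra.TensorProduct.one_def, one_mul]
        · rw [← Algebra.TensorProduct.one_def, mul_one]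
      | succ n ih => rw [pow_succ]; exact ih.mul ha
    have e : Polynomial.aeval a (Polynomial.monomial n r) = (r : ℂ) • a ^ n := by
      rw [Polynomial.aeval_monomial, ← Algebra.smul_def]; simp
    rw [e]
    constructor
    · rw [map_smul, hpow.1, ← TensorProduct.smul_tmul', smul_mul_assoc]
    · rw [map_smul, hpow.2, ← TensorProduct.smul_tmul', mul_smul_comm]

end WeakHopfData

section Tensor

variable {B : Type*} [NormedRing B] [NormedAlgebra ℂ B]

lemma map_lapp_mulLeft_assoc (φ : B →ₗ[ℂ] ℂ) (s t : B ⊗[ℂ] B) :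
    TensorProduct.map LinearMap.id (lapp φ ∘ₗ LinearMap.mulLeft ℂ t)
        (TensorProduct.assoc ℂ B B B (s ⊗ₜ[ℂ] (1 : B)))
      = TensorProduct.map (rapp φ ∘ₗ LinearMap.mulRight ℂ s ∘ₗ TensorProduct.mk ℂ B B 1)
        LinearMap.id t := by
  induction s with
  | zero => simp [LinearMap.mulRight_zero_eq_zero]
  | add s s' hs hs' =>
    have e : LinearMap.mulRight ℂ (s + s') = LinearMap.mulRight ℂ s + LinearMap.mulRight ℂ s' := by
      ext; simp [mul_add]
    rw [TensorProduct.add_tmul, map_add, map_add, hs, hs', e, LinearMap.add_comp,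
      LinearMap.comp_add, TensorProduct.map_add_left, LinearMap.add_apply]
  | tmul a b =>
    induction t with
    | zero => simp
    | add t t' ht ht' =>
      have e : LinearMap.mulLeft ℂ (t + t') = LinearMap.mulLeft ℂ t + LinearMap.mulLeft ℂ t' := by
        ext; simp [add_mul]
      rw [e, LinearMap.comp_add, TensorProduct.map_add_right, LinearMap.add_apply, ht, ht', map_add]
    | tmul c d => simp [lapp_tmul, rapp_tmul, TensorProduct.smul_tmul']

lemma map_lapp_mulRight_assoc (φ : B →ₗ[ℂ] ℂ) (s t : B ⊗[ℂ] B) :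
    TensorProduct.map LinearMap.id (lapp φ ∘ₗ LinearMap.mulRight ℂ t)
        (TensorProduct.assoc ℂ B B B (s ⊗ₜ[ℂ] (1 : B)))
      = TensorProduct.map (rapp φ ∘ₗ LinearMap.mulLeft ℂ s ∘ₗ TensorProduct.mk ℂ B B 1)
        LinearMap.id t := by
  induction s with
  | zero => simp [LinearMap.mulLeft_zero_eq_zero]
  | add s s' hs hs' =>
    have e : LinearMap.mulLeft ℂ (s + s') = LinearMap.mulLeft ℂ s + LinearMap.mulLeft ℂ s' := by
      ext; simp [add_mul]
    rw [TensorProduct.add_tmul, map_add, map_add, hs, hs', e, LinearMap.add_comp,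
      LinearMap.comp_add, TensorProduct.map_add_left, LinearMap.add_apply]
  | tmul a b =>
    induction t with
    | zero => simp
    | add t t' ht ht' =>
      have e : LinearMap.mulRight ℂ (t + t')
          = LinearMap.mulRight ℂ t + LinearMap.mulRight ℂ t' := by
        ext; simp [mul_add]
      rw [e, LinearMap.comp_add, TensorProduct.map_add_right, LinearMap.add_apply, ht, ht', map_add]
    | tmul c d => simp [lapp_tmul, rapp_tmul, TensorProduct.smul_tmul']

lemma map_rapp_mulRight_assoc_symm (φ : B →ₗ[ℂ] ℂ) (s t : B ⊗[ℂ] B) :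
    TensorProduct.map (rapp φ ∘ₗ LinearMap.mulRight ℂ t) LinearMap.id
        ((TensorProduct.assoc ℂ B B B).symm ((1 : B) ⊗ₜ[ℂ] s))
      = TensorProduct.map LinearMap.id
        (lapp φ ∘ₗ LinearMap.mulLeft ℂ s ∘ₗ (TensorProduct.mk ℂ B B).flip 1) t := by
  induction s with
  | zero => simp [LinearMap.mulLeft_zero_eq_zero]
  | add s s' hs hs' =>
    have e : LinearMap.mulLeft ℂ (s + s') = LinearMap.mulLeft ℂ s + LinearMap.mulLeft ℂ s' := by
      ext; simp [add_mul]
    rw [TensorProduct.tmul_add, map_add, map_add, hs, hs', e, LinearMap.add_comp,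
      LinearMap.comp_add, TensorProduct.map_add_right, LinearMap.add_apply]
  | tmul a b =>
    induction t with
    | zero => simp
    | add t t' ht ht' =>
      have e : LinearMap.mulRight ℂ (t + t')
          = LinearMap.mulRight ℂ t + LinearMap.mulRight ℂ t' := by
        ext; simp [mul_add]
      rw [e, LinearMap.comp_add, TensorProduct.map_add_left, LinearMap.add_apply, ht, ht', map_add]
    | tmul c d => simp [lapp_tmul, rapp_tmul, TensorProduct.smul_tmul']

/-- The flip composed with a map applied to both legs. -/
def flipMap (f : B →ₗ[ℂ] B) : B ⊗[ℂ] B →ₗ[ℂ] B ⊗[ℂ] B :=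
  (TensorProduct.comm ℂ B B).toLinearMap ∘ₗ TensorProduct.map f f

lemma flipMap_tmul (f : B →ₗ[ℂ] B) (a b : B) : flipMap f (a ⊗ₜ[ℂ] b) = f b ⊗ₜ[ℂ] f a := rfl

lemma flipMap_mul {f : B →ₗ[ℂ] B} (hf : ∀ x y, f (x * y) = f y * f x) (s t : B ⊗[ℂ] B) :
    flipMap f (s * t) = flipMap f t * flipMap f s := by
  induction s with
  | zero => simp
  | add s s' hs hs' => simp [add_mul, mul_add, hs, hs']
  | tmul a b =>
    induction t with
    | zero => simp
    | add s s' hs hs' => simp [add_mul, mul_add, hs, hs']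
    | tmul c d => simp [flipMap_tmul, hf]

lemma map_id_antimul_one_tmul_mul {f : B →ₗ[ℂ] B} (hf : ∀ x y, f (x * y) = f y * f x)
    (t : B ⊗[ℂ] B) (x : B) : TensorProduct.map LinearMap.id f ((1 : B) ⊗ₜ[ℂ] x * t)
      = TensorProduct.map LinearMap.id f t * (1 : B) ⊗ₜ[ℂ] f x := by
  induction t with
  | zero => simp
  | add s s' hs hs' => simp [add_mul, mul_add, hs, hs']
  | tmul a b => simp [hf]

lemma map_id_tmul_one_mul (f : B →ₗ[ℂ] B) (t : B ⊗[ℂ] B) (x : B) :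
    TensorProduct.map LinearMap.id f (x ⊗ₜ[ℂ] (1 : B) * t)
      = x ⊗ₜ[ℂ] (1 : B) * TensorProduct.map LinearMap.id f t := by
  induction t with
  | zero => simp
  | add s s' hs hs' => simp [mul_add, hs, hs']
  | tmul a b => simp

lemma map_id_mul_tmul_one (f : B →ₗ[ℂ] B) (t : B ⊗[ℂ] B) (x : B) :
    TensorProduct.map LinearMap.id f (t * x ⊗ₜ[ℂ] (1 : B))
      = TensorProduct.map LinearMap.id f t * x ⊗ₜ[ℂ] (1 : B) := by
  induction t with
  | zero => simp
  | add s s' hs hs' => simp [add_mul, hs, hs']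
  | tmul a b => simp

lemma mul'_tmul_one_mul (t : B ⊗[ℂ] B) (x : B) :
    LinearMap.mul' ℂ B (x ⊗ₜ[ℂ] (1 : B) * t) = x * LinearMap.mul' ℂ B t := by
  induction t with
  | zero => simp
  | add s s' hs hs' => simp [mul_add, hs, hs']
  | tmul a b => simp [mul_assoc]

lemma mul'_mul_one_tmul (t : B ⊗[ℂ] B) (x : B) :
    LinearMap.mul' ℂ B (t * (1 : B) ⊗ₜ[ℂ] x) = LinearMap.mul' ℂ B t * x := by
  induction t with
  | zero => simp
  | add s s' hs hs' => simp [add_mul, hs, hs']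
  | tmul a b => simp [mul_assoc]

end Tensor

namespace WeakHopfData

variable (W : WeakHopfData A)

/-- The counital map `x ↦ 1₍₁₎ ε(1₍₂₎ x)`. -/
def εR' : A →ₗ[ℂ] A := rapp W.ε ∘ₗ LinearMap.mulLeft ℂ (W.Δ 1) ∘ₗ TensorProduct.mk ℂ A A 1

lemma εR_eq : W.εR
    = rapp W.ε ∘ₗ LinearMap.mulRight ℂ (W.Δ 1) ∘ₗ TensorProduct.mk ℂ A A 1 := by
  ext x
  simp [εR_apply, rapp_one_tmul_mul]

lemma εL_eq : W.εL
    = lapp W.ε ∘ₗ LinearMap.mulLeft ℂ (W.Δ 1) ∘ₗ (TensorProduct.mk ℂ A A).flip 1 := by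
  ext x
  simp [εL_apply, lapp_mul_tmul_one]

lemma map_εR_Δ (x : A) :
    TensorProduct.map W.εR LinearMap.id (W.Δ x) = (1 : A) ⊗ₜ[ℂ] x * W.Δ 1 := by
  have h1 : ∀ t : A ⊗[ℂ] A, (1 : A) ⊗ₜ[ℂ] x * t = TensorProduct.map LinearMap.id
      (lapp W.ε ∘ₗ LinearMap.mulLeft ℂ (W.Δ x)) (TensorProduct.map LinearMap.id W.Δ t) := by
    intro t
    induction t with
    | zero => simp
    | add s s' hs hs' => simp [mul_add, hs, hs']
    | tmul a b => simp [← W.Δ_mul, lapp_counit]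
  have h2 : ∀ y : A ⊗[ℂ] (A ⊗[ℂ] A), TensorProduct.map LinearMap.id
      (lapp W.ε ∘ₗ LinearMap.mulLeft ℂ (W.Δ x)) ((1 : A) ⊗ₜ[ℂ] W.Δ 1 * y)
      = TensorProduct.map LinearMap.id (lapp W.ε ∘ₗ LinearMap.mulLeft ℂ (W.Δ x)) y := by
    intro y
    induction y with
    | zero => simp
    | add s s' hs hs' => simp only [mul_add, map_add, hs, hs']
    | tmul a b => simp [← mul_assoc, Δ_mul_one]
  rw [h1, map_id_Δ_one', h2, map_lapp_mulLeft_assoc, εR_eq]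

lemma map_εR'_Δ (x : A) :
    TensorProduct.map W.εR' LinearMap.id (W.Δ x) = W.Δ 1 * (1 : A) ⊗ₜ[ℂ] x := by
  have h1 : ∀ t : A ⊗[ℂ] A, t * (1 : A) ⊗ₜ[ℂ] x = TensorProduct.map LinearMap.id
      (lapp W.ε ∘ₗ LinearMap.mulRight ℂ (W.Δ x)) (TensorProduct.map LinearMap.id W.Δ t) := by
    intro t
    induction t with
    | zero => simp
    | add s s' hs hs' => simp [add_mul, hs, hs']
    | tmul a b => simp [← W.Δ_mul, lapp_counit]
  have h2 : ∀ y : A ⊗[ℂ] (A ⊗[ℂ] A), TensorProduct.map LinearMap.id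
      (lapp W.ε ∘ₗ LinearMap.mulRight ℂ (W.Δ x)) (y * (1 : A) ⊗ₜ[ℂ] W.Δ 1)
      = TensorProduct.map LinearMap.id (lapp W.ε ∘ₗ LinearMap.mulRight ℂ (W.Δ x)) y := by
    intro y
    induction y with
    | zero => simp
    | add s s' hs hs' => simp only [add_mul, map_add, hs, hs']
    | tmul a b => simp [mul_assoc, Δ_one_mul]
  rw [h1, map_id_Δ_one, h2, map_lapp_mulRight_assoc, εR']

lemma map_εL_Δ (x : A) :
    TensorProduct.map LinearMap.id W.εL (W.Δ x) = W.Δ 1 * x ⊗ₜ[ℂ] (1 : A) := by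
  have h1 : ∀ t : A ⊗[ℂ] A, t * x ⊗ₜ[ℂ] (1 : A) = TensorProduct.map
      (rapp W.ε ∘ₗ LinearMap.mulRight ℂ (W.Δ x)) LinearMap.id
      (TensorProduct.map W.Δ LinearMap.id t) := by
    intro t
    induction t with
    | zero => simp
    | add s s' hs hs' => simp [add_mul, hs, hs']
    | tmul a b => simp [← W.Δ_mul, rapp_counit]
  have h2 : ∀ y : (A ⊗[ℂ] A) ⊗[ℂ] A, TensorProduct.map
      (rapp W.ε ∘ₗ LinearMap.mulRight ℂ (W.Δ x)) LinearMap.id (y * W.Δ 1 ⊗ₜ[ℂ] (1 : A))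
      = TensorProduct.map (rapp W.ε ∘ₗ LinearMap.mulRight ℂ (W.Δ x)) LinearMap.id y := by
    intro y
    induction y with
    | zero => simp
    | add s s' hs hs' => simp only [add_mul, map_add, hs, hs']
    | tmul a b => simp [mul_assoc, Δ_one_mul]
  rw [h1, Δ_one_weak', h2, map_rapp_mulRight_assoc_symm, εL_eq]

lemma S_mul (x y : A) : W.S.toLinearMap (x * y) = W.S.toLinearMap y * W.S.toLinearMap x :=
  W.S_antimul x y

lemma flipMap_S_Δ (x : A) : flipMap W.S.toLinearMap (W.Δ x) = W.Δ (W.S x) :=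
  (W.S_anticomul x).symm

lemma εL_one : W.εL 1 = 1 := by
  have e : W.ε ∘ₗ LinearMap.mulRight ℂ 1 = W.ε := by ext; simp
  rw [εL_apply, e, lapp_counit]

lemma ε_S (x : A) : W.ε (W.S x) = W.ε x := by
  have h : ∀ t : A ⊗[ℂ] A, W.S (rapp (W.ε ∘ₗ W.S.toLinearMap) t)
      = lapp W.ε (flipMap W.S.toLinearMap t) := by
    intro t
    induction t with
    | zero => simp
    | add s s' hs hs' => simp [hs, hs']
    | tmul a b => simp [lapp_tmul, rapp_tmul, flipMap_tmul]
  have h1 : rapp (W.ε ∘ₗ W.S.toLinearMap) (W.Δ x) = x := by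
    apply W.S.injective
    rw [h, flipMap_S_Δ, lapp_counit]
  have h2 : ∀ t : A ⊗[ℂ] A, W.ε (rapp (W.ε ∘ₗ W.S.toLinearMap) t) = W.ε (W.S (lapp W.ε t)) := by
    intro t
    induction t with
    | zero => simp
    | add s s' hs hs' => simp [hs, hs']
    | tmul a b => simp [lapp_tmul, rapp_tmul, mul_comm]
  have h3 := h2 (W.Δ x)
  rw [h1, lapp_counit] at h3
  exact h3.symm

variable {W} in
lemma IsLeft.map_S {a : A} (ha : W.IsLeft a) : W.IsRight (W.S a) := by
  have e : flipMap W.S.toLinearMap (a ⊗ₜ[ℂ] (1 : A)) = (1 : A) ⊗ₜ[ℂ] W.S a := by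
    simp [flipMap_tmul, S_one]
  constructor
  · rw [← flipMap_S_Δ, ha.2, flipMap_mul W.S_mul, flipMap_S_Δ, e, S_one]
  · rw [← flipMap_S_Δ, ha.1, flipMap_mul W.S_mul, flipMap_S_Δ, e, S_one]

variable {W} in
lemma IsLeft.one_tmul_mul_Δ_one {a : A} (ha : W.IsLeft a) :
    (1 : A) ⊗ₜ[ℂ] a * W.Δ 1 = W.S a ⊗ₜ[ℂ] (1 : A) * W.Δ 1 := by
  have h0 : ∀ t : A ⊗[ℂ] A, LinearMap.mul' ℂ A (TensorProduct.map W.S.toLinearMap LinearMap.id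
      (t * a ⊗ₜ[ℂ] (1 : A))) = W.S a * LinearMap.mul' ℂ A
        (TensorProduct.map W.S.toLinearMap LinearMap.id t) := by
    intro t
    induction t with
    | zero => simp
    | add s s' hs hs' => simp [add_mul, mul_add, hs, hs']
    | tmul c d => simp [W.S_antimul, mul_assoc]
  have h1 : ∀ x : A, W.εR (x * a) = W.S a * W.εR x := by
    intro x
    have e : W.Δ (x * a) = W.Δ x * a ⊗ₜ[ℂ] (1 : A) := by
      rw [W.Δ_mul, ha.1]
      have := ha.1.symm.trans ha.2
      rw [this, ← mul_assoc, Δ_mul_one]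
    simp only [εR, LinearMap.comp_apply]
    rw [e, h0]
  have h2 : ∀ t : A ⊗[ℂ] A, TensorProduct.map W.εR LinearMap.id (t * a ⊗ₜ[ℂ] (1 : A))
      = W.S a ⊗ₜ[ℂ] (1 : A) * TensorProduct.map W.εR LinearMap.id t := by
    intro t
    induction t with
    | zero => simp
    | add s s' hs hs' => simp [add_mul, mul_add, hs, hs']
    | tmul c d => simp [h1]
  rw [← map_εR_Δ, ha.2, h2, map_εR_Δ, ← Algebra.TensorProduct.one_def, one_mul]

lemma εR_eq_S_lapp (x : A) : W.εR x = W.S (lapp (W.ε ∘ₗ LinearMap.mulLeft ℂ x) (W.Δ 1)) := by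
  set u := lapp (W.ε ∘ₗ LinearMap.mulLeft ℂ x) (W.Δ 1) with hu
  have hl : W.IsLeft u := W.isLeft_lapp _
  have h1 := congrArg (rapp W.ε) hl.one_tmul_mul_Δ_one
  rw [rapp_tmul_one_mul, rapp_counit, mul_one, rapp_one_tmul_mul] at h1
  rw [← h1, εR_apply]
  congr 2
  have h2 : ∀ (y : A) (t : A ⊗[ℂ] A), papp (W.ε ∘ₗ LinearMap.mulLeft ℂ x)
      (W.ε ∘ₗ LinearMap.mulRight ℂ y) t = W.ε (lapp (W.ε ∘ₗ LinearMap.mulLeft ℂ x) t * y) := by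
    intro y t
    induction t with
    | zero => simp
    | add s s' hs hs' => simp [add_mul, hs, hs']
    | tmul c d => simp [papp, lapp_tmul]
  ext y
  have h3 := W.ε_weak x 1 y
  rw [h2, mul_one] at h3
  simpa using h3

lemma εR'_S (x : A) : W.εR' (W.S x) = W.εR x := by
  have h : ∀ t : A ⊗[ℂ] A, rapp W.ε (flipMap W.S.toLinearMap t * (1 : A) ⊗ₜ[ℂ] W.S x)
      = W.S (lapp (W.ε ∘ₗ LinearMap.mulLeft ℂ x) t) := by
    intro t
    induction t with
    | zero => simp
    | add s s' hs hs' => simp [add_mul, hs, hs']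
    | tmul c d => simp [flipMap_tmul, rapp_tmul, lapp_tmul, ← W.S_antimul, ε_S]
  rw [εR_eq_S_lapp, ← h, flipMap_S_Δ, S_one]
  simp [εR']

lemma mul'_εR_S (x : A) : LinearMap.mul' ℂ A (TensorProduct.map LinearMap.id W.S.toLinearMap
    (TensorProduct.map W.εR LinearMap.id (W.Δ x))) = W.S x := by
  rw [map_εR_Δ, map_id_antimul_one_tmul_mul W.S_mul, mul'_mul_one_tmul]
  have := W.εL_one
  simp only [εL, LinearMap.comp_apply] at this
  rw [this, one_mul]
  rfl

/-- A right integral moves multiplication on the first leg of its coproduct to the second leg. -/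
lemma Δ_integral_mul_tmul_one {h : A} (hh : ∀ x : A, h * x = h * W.εR x) (x : A) :
    W.Δ h * x ⊗ₜ[ℂ] (1 : A) = W.Δ h * (1 : A) ⊗ₜ[ℂ] W.S x := by
  let Ψ : A ⊗[ℂ] A →ₗ[ℂ] A ⊗[ℂ] A := TensorProduct.lift
    ((LinearMap.mul ℂ (A ⊗[ℂ] A)).compl₁₂ (W.Δ ∘ₗ LinearMap.mulLeft ℂ h)
      (TensorProduct.mk ℂ A A 1 ∘ₗ W.S.toLinearMap))
  have hΨ : ∀ a b, Ψ (a ⊗ₜ[ℂ] b) = W.Δ (h * a) * (1 : A) ⊗ₜ[ℂ] W.S b := fun a b => rfl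
  have h1 : ∀ t, Ψ t = W.Δ h * (1 : A) ⊗ₜ[ℂ] LinearMap.mul' ℂ A
      (TensorProduct.map LinearMap.id W.S.toLinearMap
        (TensorProduct.map W.εR LinearMap.id t)) := by
    intro t
    induction t with
    | zero => simp
    | add s s' hs hs' => simp only [map_add, hs, hs', TensorProduct.tmul_add, mul_add]
    | tmul c d =>
      rw [hΨ, hh, W.Δ_mul, (W.isRight_εR c).2, ← mul_assoc, Δ_mul_one, mul_assoc]
      simp
  have h2 : ∀ s : (A ⊗[ℂ] A) ⊗[ℂ] A, TensorProduct.map LinearMap.id (LinearMap.mul' ℂ A ∘ₗ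
        TensorProduct.map LinearMap.id W.S.toLinearMap) (TensorProduct.assoc ℂ A A A s)
      = TensorProduct.lift ((LinearMap.mul ℂ (A ⊗[ℂ] A)).compl₁₂ LinearMap.id
        (TensorProduct.mk ℂ A A 1 ∘ₗ W.S.toLinearMap)) s := by
    intro s
    induction s with
    | zero => simp
    | add s s' hs hs' => simp only [map_add, hs, hs']
    | tmul u c =>
      induction u with
      | zero => simp
      | add s s' hs hs' => simp only [map_add, TensorProduct.add_tmul, hs, hs']
      | tmul a b => simp
  have h3 : ∀ t, Ψ t = W.Δ h * TensorProduct.lift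
      ((LinearMap.mul ℂ (A ⊗[ℂ] A)).compl₁₂ LinearMap.id
        (TensorProduct.mk ℂ A A 1 ∘ₗ W.S.toLinearMap))
      (TensorProduct.map W.Δ LinearMap.id t) := by
    intro t
    induction t with
    | zero => simp
    | add s s' hs hs' => simp only [map_add, hs, hs', mul_add]
    | tmul c d => rw [hΨ, W.Δ_mul]; simp [mul_assoc]
  have h4 : ∀ t : A ⊗[ℂ] A, TensorProduct.map LinearMap.id (LinearMap.mul' ℂ A ∘ₗ
      TensorProduct.map LinearMap.id W.S.toLinearMap) (TensorProduct.map LinearMap.id W.Δ t)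
      = TensorProduct.map LinearMap.id W.εL t := by
    intro t
    induction t with
    | zero => simp
    | add s s' hs hs' => simp only [map_add, hs, hs']
    | tmul c d => simp [εL]
  have h5 := h1 (W.Δ x)
  rw [mul'_εR_S, h3, ← h2, coassoc_apply, h4, map_εL_Δ, ← mul_assoc, Δ_mul_one] at h5
  exact h5

/-- The pulling-through identity for an antipode-invariant integral. -/
lemma tmul_one_mul_map_S_Δ {h : A} (hh : ∀ x : A, h * x = h * W.εR x) (hS : W.S h = h) (x : A) :
    x ⊗ₜ[ℂ] (1 : A) * TensorProduct.map LinearMap.id W.S.toLinearMap (W.Δ h)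
      = TensorProduct.map LinearMap.id W.S.toLinearMap (W.Δ h) * (1 : A) ⊗ₜ[ℂ] x := by
  obtain ⟨y, rfl⟩ := W.S.surjective x
  obtain ⟨z, rfl⟩ := W.S.surjective y
  have h1 := congrArg (flipMap W.S.toLinearMap) (W.Δ_integral_mul_tmul_one hh z)
  rw [flipMap_mul W.S_mul, flipMap_mul W.S_mul, flipMap_S_Δ, hS, flipMap_tmul, flipMap_tmul] at h1
  simp only [LinearEquiv.coe_coe, S_one] at h1
  have h2 := congrArg (TensorProduct.map LinearMap.id W.S.toLinearMap) h1
  rw [map_id_antimul_one_tmul_mul W.S_mul, map_id_tmul_one_mul] at h2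
  exact h2.symm

end WeakHopfData

section PositiveElements

lemma finite_real_spectrum_of_finiteDimensional {R : Type*} [Ring R] [Algebra ℝ R]
    [FiniteDimensional ℝ R] (a : R) : (spectrum ℝ a).Finite := by
  nontriviality R
  refine ((minpoly ℝ a).rootSet_finite ℝ).subset fun k hk => ?_
  have h := spectrum.subset_polynomial_aeval a (minpoly ℝ a) ⟨k, hk, rfl⟩
  rw [minpoly.aeval, spectrum.zero_eq] at h
  rw [Polynomial.mem_rootSet_of_ne (minpoly.ne_zero (Algebra.IsIntegral.isIntegral a))]
  simpa using h

variable {B : Type*} [CStarAlgebra B] [PartialOrder B] [StarOrderedRing B]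

lemma isPosElem_iff_nonneg (x : B) : IsPosElem x ↔ 0 ≤ x :=
  CStarAlgebra.nonneg_iff_eq_star_mul_self.symm

lemma exists_polynomial_sqrt_of_nonneg [FiniteDimensional ℂ B] {a b : B} (ha : 0 ≤ a)
    (hb : 0 ≤ b) : ∃ p : Polynomial ℝ, Polynomial.aeval a p = CFC.sqrt a ∧
      Polynomial.aeval b p = CFC.sqrt b := by
  classical
  have : FiniteDimensional ℝ B := FiniteDimensional.complexToReal B
  let s : Finset ℝ := (finite_real_spectrum_of_finiteDimensional a).toFinset ∪
    (finite_real_spectrum_of_finiteDimensional b).toFinset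
  refine ⟨Lagrange.interpolate s id Real.sqrt, ?_, ?_⟩
  · rw [CFC.sqrt_eq_real_sqrt a, cfcₙ_eq_cfc, ← cfc_polynomial _ a]
    refine cfc_congr fun x hx => ?_
    exact Lagrange.eval_interpolate_at_node (v := id) Real.sqrt Function.injective_id.injOn
      (Finset.mem_union_left _ (by simpa using hx))
  · rw [CFC.sqrt_eq_real_sqrt b, cfcₙ_eq_cfc, ← cfc_polynomial _ b]
    refine cfc_congr fun x hx => ?_
    exact Lagrange.eval_interpolate_at_node (v := id) Real.sqrt Function.injective_id.injOn
      (Finset.mem_union_right _ (by simpa using hx))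

end PositiveElements

section PositiveTransfer

/-- The `C*`-algebra structure of a finite-dimensional space, whose completeness is automatic. -/
abbrev finiteDimensionalCStarAlgebra (A : Type*) [NormedRing A] [StarRing A] [CStarRing A]
    [NormedAlgebra ℂ A] [StarModule ℂ A] [FiniteDimensional ℂ A] : CStarAlgebra A :=
  { ‹NormedRing A›, ‹StarRing A›, ‹CStarRing A›, ‹NormedAlgebra ℂ A›, ‹StarModule ℂ A› with
    toCompleteSpace := FiniteDimensional.complete ℂ A }

lemma IsPosElem.star_eq {R : Type*} [Mul R] [StarMul R] {x : R} (hx : IsPosElem x) : star x = x := by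
  obtain ⟨y, rfl⟩ := hx
  simp

lemma IsPosElem.eq_of_mul_self_eq {x y : A} (hx : IsPosElem x) (hy : IsPosElem y)
    (h : x * x = y * y) : x = y := by
  let _ := finiteDimensionalCStarAlgebra A
  let _ := CStarAlgebra.spectralOrder A
  have := CStarAlgebra.spectralOrderedRing A
  have hx' := (isPosElem_iff_nonneg x).1 hx
  have hy' := (isPosElem_iff_nonneg y).1 hy
  rw [← CFC.sqrt_unique h hx', CFC.sqrt_unique rfl hy']

lemma IsPosElem.mul_of_commute {x y : A} (hx : IsPosElem x) (hy : IsPosElem y)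
    (h : x * y = y * x) : IsPosElem (x * y) := by
  let _ := finiteDimensionalCStarAlgebra A
  let _ := CStarAlgebra.spectralOrder A
  have := CStarAlgebra.spectralOrderedRing A
  exact (isPosElem_iff_nonneg _).2 (Commute.mul_nonneg ((isPosElem_iff_nonneg x).1 hx)
    ((isPosElem_iff_nonneg y).1 hy) h)

lemma isPosElem_sum {ι : Type*} (s : Finset ι) (f : ι → A) (hf : ∀ i, IsPosElem (f i)) :
    IsPosElem (∑ i ∈ s, f i) := by
  let _ := finiteDimensionalCStarAlgebra A
  let _ := CStarAlgebra.spectralOrder A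
  have := CStarAlgebra.spectralOrderedRing A
  exact (isPosElem_iff_nonneg _).2
    (Finset.sum_nonneg fun i _ => (isPosElem_iff_nonneg _).1 (hf i))

lemma IsPosElem.exists_polynomial_sqrt {a b : A} (ha : IsPosElem a) (hb : IsPosElem b) :
    ∃ p : Polynomial ℝ,
      (IsPosElem (Polynomial.aeval a p) ∧ Polynomial.aeval a p * Polynomial.aeval a p = a) ∧
      (IsPosElem (Polynomial.aeval b p) ∧ Polynomial.aeval b p * Polynomial.aeval b p = b) := by
  let _ := finiteDimensionalCStarAlgebra A
  let _ := CStarAlgebra.spectralOrder A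
  have := CStarAlgebra.spectralOrderedRing A
  have ha' := (isPosElem_iff_nonneg a).1 ha
  have hb' := (isPosElem_iff_nonneg b).1 hb
  obtain ⟨p, hpa, hpb⟩ := exists_polynomial_sqrt_of_nonneg ha' hb'
  refine ⟨p, ?_, ?_⟩
  · rw [hpa]
    exact ⟨(isPosElem_iff_nonneg _).2 (CFC.sqrt_nonneg a), CFC.sqrt_mul_sqrt_self a⟩
  · rw [hpb]
    exact ⟨(isPosElem_iff_nonneg _).2 (CFC.sqrt_nonneg b), CFC.sqrt_mul_sqrt_self b⟩

lemma IsPosElem.units_inv {R : Type*} [Ring R] [StarRing R] {u : Rˣ}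
    (hu : IsPosElem (u : R)) : IsPosElem (↑u⁻¹ : R) := by
  have hs := hu.star_eq
  obtain ⟨y, hy⟩ := hu
  have hs' : star (↑u⁻¹ : R) = ↑u⁻¹ := by
    rw [← Units.coe_star_inv]
    congr 2
    exact Units.ext hs
  refine ⟨y * ↑u⁻¹, ?_⟩
  rw [star_mul, hs', mul_assoc, ← mul_assoc (star y), ← hy, Units.mul_inv, mul_one]

lemma exists_reconstructing_family {V : Type*} [AddCommGroup V] [Module ℂ V]
    [FiniteDimensional ℂ V] (c : InnerProductSpace.Core ℂ V) :
    ∃ (n : ℕ) (e : Fin n → V), ∀ x, ∑ i, c.inner (e i) x • e i = x := by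
  let _ : NormedAddCommGroup V := c.toNormedAddCommGroup
  let _ : InnerProductSpace ℂ V := InnerProductSpace.ofCore c.toCore
  exact ⟨_, stdOrthonormalBasis ℂ V, (stdOrthonormalBasis ℂ V).sum_repr'⟩

lemma apply_star_of_pos {R : Type*} [Ring R] [StarRing R] [Algebra ℂ R] [StarModule ℂ R]
    {φ : R →ₗ[ℂ] ℂ} (hφ : ∀ x : R, ∃ r : ℝ, 0 ≤ r ∧ φ (star x * x) = (r : ℂ)) (x : R) :
    φ (star x) = (starRingEnd ℂ) (φ x) := by
  obtain ⟨r₁, -, h₁⟩ := hφ (x + 1)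
  obtain ⟨r₂, -, h₂⟩ := hφ (Complex.I • x + 1)
  obtain ⟨r₃, -, h₃⟩ := hφ x
  obtain ⟨r₄, -, h₄⟩ := hφ 1
  simp only [star_add, star_one, star_smul, add_mul, mul_add, one_mul, mul_one, map_add, map_smul,
    smul_mul_assoc, mul_smul_comm, smul_eq_mul, h₃] at h₁ h₂ h₄
  rw [h₄] at h₁ h₂
  have a1 := congrArg Complex.im h₁
  have a2 := congrArg Complex.im h₂
  simp at a1 a2
  apply Complex.ext
  · simp; linarith
  · simp; linarith

/-- The positive semidefinite form `⟨x, y⟩ = φ(x* y)` of a positive functional. -/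
abbrev gnsPreCore {R : Type*} [Ring R] [StarRing R] [Algebra ℂ R] [StarModule ℂ R]
    {φ : R →ₗ[ℂ] ℂ}
    (hφ : ∀ x : R, ∃ r : ℝ, 0 ≤ r ∧ φ (star x * x) = (r : ℂ)) :
    PreInnerProductSpace.Core ℂ R where
  inner x y := φ (star x * y)
  conj_inner_symm x y := by rw [← apply_star_of_pos hφ]; simp
  re_inner_nonneg x := by
    obtain ⟨r, hr, h⟩ := hφ x
    simpa [h] using hr
  add_left x y z := by simp [add_mul]
  smul_left x y r := by simp

lemma apply_mul_eq_zero_of_pos {R : Type*} [Ring R] [StarRing R] [Algebra ℂ R] [StarModule ℂ R]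
    {φ : R →ₗ[ℂ] ℂ} (hφ : ∀ x : R, ∃ r : ℝ, 0 ≤ r ∧ φ (star x * x) = (r : ℂ)) {x : R}
    (hx : φ (star x * x) = 0) (y : R) : φ (y * x) = 0 := by
  let c := gnsPreCore hφ
  have h := InnerProductSpace.Core.inner_mul_inner_self_le (𝕜 := ℂ) (c := c) (star y) x
  have e : c.inner x x = 0 := hx
  have e' : c.inner (star y) x = φ (y * x) := by
    change φ (star (star y) * x) = _
    rw [star_star]
  have e'' : c.inner x (star y) = (starRingEnd ℂ) (φ (y * x)) := by
    rw [← e', c.conj_inner_symm]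
  change ‖c.inner (star y) x‖ * ‖c.inner x (star y)‖ ≤ _ * RCLike.re (c.inner x x) at h
  rw [e, e', e'', RCLike.norm_conj, map_zero, mul_zero] at h
  exact norm_eq_zero.1 (mul_self_eq_zero.1 (le_antisymm h (mul_self_nonneg _)))

end PositiveTransfer

section RingInverse

variable {M : Type*} [MonoidWithZero M]

lemma commute_ringInverse_right {x y : M} (h : Commute x y) : Commute x (Ring.inverse y) := by
  by_cases hy : IsUnit y
  · obtain ⟨u, rfl⟩ := hy
    rw [Ring.inverse_unit]
    exact h.units_inv_right
  · rw [Ring.inverse_non_unit _ hy]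
    exact Commute.zero_right x

lemma ringInverse_eq_of_mul_eq_one {x y : M} (hx : IsUnit x) (h : x * y = 1) :
    Ring.inverse x = y := by
  rw [← Ring.inverse_mul_cancel_left x y hx, h, mul_one]

end RingInverse

namespace WeakHopfData

variable (W : WeakHopfData A)

lemma S_ringInverse {x : A} (hx : IsUnit x) (hSx : IsUnit (W.S x)) :
    W.S (Ring.inverse x) = Ring.inverse (W.S x) :=
  (ringInverse_eq_of_mul_eq_one hSx (by
    rw [← W.S_antimul, Ring.inverse_mul_cancel x hx, W.S_one])).symm

end WeakHopfData

namespace HaarPkg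

variable (P : HaarPkg A)

lemma isLeft_gL : P.W.IsLeft P.gL := by
  obtain ⟨x, hx⟩ := P.gL_mem
  exact hx ▸ P.W.isLeft_εL x

lemma S_ringInverse_gL : P.W.S (Ring.inverse P.gL) = Ring.inverse P.gR := by
  rw [P.W.S_ringInverse P.gL_unit (P.gR_S ▸ P.gR_unit), ← P.gR_S]

lemma gL_mul_gR_mul_g : P.gL * P.gR * P.g = P.gL * P.gL := by
  rw [g, P.gLR_comm, mul_assoc, ← mul_assoc P.gL, ← mul_assoc, ← mul_assoc, ← P.gLR_comm,
    mul_assoc P.gL P.gR, ← P.gLR_comm, ← mul_assoc, Ring.mul_inverse_cancel_right _ _ P.gR_unit]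

lemma ringInverse_g_mul : Ring.inverse P.g * Ring.inverse (P.gL * P.gR)
    = Ring.inverse P.gL * Ring.inverse P.gL := by
  rw [← Ring.inverse_mul (Or.inl (P.gL_unit.mul P.gR_unit)), gL_mul_gR_mul_g,
    Ring.inverse_mul (Or.inl P.gL_unit)]

/-- The tensor `h₍₁₎ ⊗ S(h₍₂₎)`. -/
def haarPull : A ⊗[ℂ] A := TensorProduct.map LinearMap.id P.W.S.toLinearMap (P.W.Δ P.h)

/-- The quasi-basis `(h gL⁻²)₍₁₎ ⊗ S((h gL⁻²)₍₂₎)` of the dual Haar integral. -/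
def quasiBasis : A ⊗[ℂ] A := TensorProduct.map LinearMap.id P.W.S.toLinearMap
  (P.W.Δ (P.h * (Ring.inverse P.gL * Ring.inverse P.gL)))

lemma quasiBasis_eq : P.quasiBasis
    = P.haarPull * (Ring.inverse P.gL * Ring.inverse P.gL) ⊗ₜ[ℂ] (1 : A) := by
  rw [quasiBasis, haarPull, P.W.Δ_mul, (P.isLeft_gL.inverse.mul P.isLeft_gL.inverse).2,
    ← mul_assoc, P.W.Δ_mul_one, map_id_mul_tmul_one]

lemma tmul_one_mul_haarPull (x : A) :
    x ⊗ₜ[ℂ] (1 : A) * P.haarPull = P.haarPull * (1 : A) ⊗ₜ[ℂ] x :=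
  P.W.tmul_one_mul_map_S_Δ P.haar_right P.haar_S x

lemma tmul_one_mul_quasiBasis (x : A) :
    x ⊗ₜ[ℂ] (1 : A) * P.quasiBasis = P.quasiBasis * (1 : A) ⊗ₜ[ℂ] x := by
  rw [quasiBasis_eq, ← mul_assoc, tmul_one_mul_haarPull, mul_assoc, mul_assoc]
  simp

lemma rapp_hHat_quasiBasis : rapp P.hHat P.quasiBasis = 1 := by
  have e : P.hHat ∘ₗ P.W.S.toLinearMap = P.hHat := LinearMap.ext P.hHat_S
  rw [quasiBasis, rapp_map_id, e, P.hHat_dual₃]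

lemma rapp_mulRight_quasiBasis (x : A) :
    rapp (P.hHat ∘ₗ LinearMap.mulRight ℂ x) P.quasiBasis = x := by
  rw [← rapp_mul_one_tmul, ← tmul_one_mul_quasiBasis, rapp_tmul_one_mul, rapp_hHat_quasiBasis,
    mul_one]

lemma eq_zero_of_hHat_star_mul_self {x : A} (hx : P.hHat (star x * x) = 0) : x = 0 := by
  rw [← P.rapp_mulRight_quasiBasis x]
  have e : P.hHat ∘ₗ LinearMap.mulRight ℂ x = 0 :=
    LinearMap.ext fun y => apply_mul_eq_zero_of_pos P.hHat_pos hx y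
  rw [e]
  simp [rapp]

lemma lapp_mulLeft_quasiBasis (x : A) :
    lapp (P.hHat ∘ₗ LinearMap.mulLeft ℂ x) P.quasiBasis = x := by
  have h : ∀ (y : A) (t : A ⊗[ℂ] A), P.hHat (lapp (P.hHat ∘ₗ LinearMap.mulLeft ℂ x) t * y)
      = P.hHat (x * rapp (P.hHat ∘ₗ LinearMap.mulRight ℂ y) t) := by
    intro y t
    induction t with
    | zero => simp
    | add s s' hs hs' => simp only [map_add, add_mul, mul_add, hs, hs']
    | tmul a b => simp [lapp_tmul, rapp_tmul, mul_comm]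
  set z := lapp (P.hHat ∘ₗ LinearMap.mulLeft ℂ x) P.quasiBasis with hz
  have h0 : star (z - x) = 0 := by
    apply P.eq_zero_of_hHat_star_mul_self
    rw [star_star, sub_mul, map_sub, hz, h, rapp_mulRight_quasiBasis, sub_self]
  exact sub_eq_zero.1 (star_eq_zero.1 h0)

/-- The quasi-basis is invariant under exchanging its legs and twisting by the modular
automorphism `x ↦ (gL gR) x (gL gR)⁻¹`. -/
lemma map_modular_comm_quasiBasis :
    TensorProduct.map (LinearMap.mulLeft ℂ (P.gL * P.gR) ∘ₗ
      LinearMap.mulRight ℂ (Ring.inverse (P.gL * P.gR))) LinearMap.id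
      (TensorProduct.comm ℂ A A P.quasiBasis) = P.quasiBasis := by
  set w := P.gL * P.gR with hw
  set c := Ring.inverse P.gL * Ring.inverse P.gL with hc
  have h1 : ∀ t : A ⊗[ℂ] A, TensorProduct.comm ℂ A A (TensorProduct.map LinearMap.id
      P.W.S.toLinearMap (flipMap P.W.S.toLinearMap t)) = P.g ⊗ₜ[ℂ] (1 : A) *
      TensorProduct.map LinearMap.id P.W.S.toLinearMap t * Ring.inverse P.g ⊗ₜ[ℂ] (1 : A) := by
    intro t
    induction t with
    | zero => simp
    | add s s' hs hs' => simp only [map_add, add_mul, mul_add, hs, hs']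
    | tmul a b => simp [flipMap_tmul, P.S_sq, g]
  have h2 : TensorProduct.comm ℂ A A P.haarPull
      = P.g ⊗ₜ[ℂ] (1 : A) * P.haarPull * Ring.inverse P.g ⊗ₜ[ℂ] (1 : A) := by
    rw [haarPull, ← h1, P.W.flipMap_S_Δ, P.haar_S]
  have h3 : ∀ t : A ⊗[ℂ] A, TensorProduct.map (LinearMap.mulLeft ℂ w ∘ₗ
      LinearMap.mulRight ℂ (Ring.inverse w)) LinearMap.id
      (TensorProduct.comm ℂ A A (t * c ⊗ₜ[ℂ] (1 : A))) = w ⊗ₜ[ℂ] (1 : A) *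
      TensorProduct.comm ℂ A A t * Ring.inverse w ⊗ₜ[ℂ] c := by
    intro t
    induction t with
    | zero => simp
    | add s s' hs hs' => simp only [map_add, add_mul, mul_add, hs, hs']
    | tmul a b => simp [mul_assoc]
  have h4 : w * P.g * c = 1 := by
    rw [gL_mul_gR_mul_g, hc, ← mul_assoc, Ring.mul_inverse_cancel_right _ _ P.gL_unit,
      Ring.mul_inverse_cancel _ P.gL_unit]
  rw [quasiBasis_eq, h3, h2]
  simp only [← mul_assoc, Algebra.TensorProduct.tmul_mul_tmul, one_mul]
  rw [tmul_one_mul_haarPull, mul_assoc, mul_assoc]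
  simp only [Algebra.TensorProduct.tmul_mul_tmul, one_mul, h4]
  rw [hw, P.ringInverse_g_mul]

lemma hHat_mul_modular (p q : A) :
    P.hHat (q * (P.gL * P.gR * p * Ring.inverse (P.gL * P.gR))) = P.hHat (p * q) := by
  have h : ∀ (f : A →ₗ[ℂ] A) (t : A ⊗[ℂ] A),
      P.hHat (q * f (lapp (P.hHat ∘ₗ LinearMap.mulLeft ℂ p) t))
      = P.hHat (p * lapp (P.hHat ∘ₗ LinearMap.mulLeft ℂ q)
        (TensorProduct.map f LinearMap.id (TensorProduct.comm ℂ A A t))) := by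
    intro f t
    induction t with
    | zero => simp
    | add s s' hs hs' => simp only [map_add, mul_add, hs, hs']
    | tmul a b => simp [lapp_tmul, mul_comm]
  have h1 := h (LinearMap.mulLeft ℂ (P.gL * P.gR) ∘ₗ
      LinearMap.mulRight ℂ (Ring.inverse (P.gL * P.gR))) P.quasiBasis
  rw [map_modular_comm_quasiBasis, lapp_mulLeft_quasiBasis, lapp_mulLeft_quasiBasis] at h1
  simpa [mul_assoc] using h1

lemma iotaEl_eq : P.iotaEl = LinearMap.mul' ℂ A P.quasiBasis := rfl

lemma commute_iotaEl (x : A) : Commute P.iotaEl x := by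
  change P.iotaEl * x = x * P.iotaEl
  rw [iotaEl_eq, ← mul'_mul_one_tmul, ← tmul_one_mul_quasiBasis, mul'_tmul_one_mul]

lemma exists_hHat_reconstructing_family :
    ∃ (n : ℕ) (e : Fin n → A), ∀ x, ∑ i, P.hHat (star (e i) * x) • e i = x :=
  exists_reconstructing_family
    { gnsPreCore P.hHat_pos with definite := fun _ hx => P.eq_zero_of_hHat_star_mul_self hx }

lemma isPosElem_iotaEl : IsPosElem P.iotaEl := by
  obtain ⟨n, e, he⟩ := P.exists_hHat_reconstructing_family
  have he' : ∀ y, ∑ i, P.hHat (y * e i) • star (e i) = y := fun y => by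
    have h := congrArg star (he (star y))
    rw [star_sum, star_star] at h
    refine (Finset.sum_congr rfl fun i _ => ?_).trans h
    rw [star_smul]
    congr 1
    rw [Complex.star_def, ← apply_star_of_pos P.hHat_pos, star_mul, star_star, star_star]
  have h : ∀ t : A ⊗[ℂ] A, LinearMap.mul' ℂ A t
      = ∑ i, rapp (P.hHat ∘ₗ LinearMap.mulRight ℂ (e i)) t * star (e i) := by
    intro t
    induction t with
    | zero => simp
    | add s s' hs hs' => simp only [map_add, add_mul, hs, hs', Finset.sum_add_distrib]
    | tmul a b =>
      conv_lhs => rw [← he' b]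
      simp [rapp_tmul, Finset.mul_sum]
  rw [iotaEl_eq, h]
  refine isPosElem_sum _ _ fun i => ⟨star (e i), ?_⟩
  rw [rapp_mulRight_quasiBasis, star_star]

end HaarPkg

section Tensor

variable {B : Type*} [NormedRing B] [NormedAlgebra ℂ B]

lemma lapp_tmul_mul (φ : B →ₗ[ℂ] ℂ) (t : B ⊗[ℂ] B) (x y : B) :
    lapp φ (x ⊗ₜ[ℂ] y * t) = y * lapp (φ ∘ₗ LinearMap.mulLeft ℂ x) t := by
  induction t with
  | zero => simp
  | add s s' hs hs' => simp only [map_add, mul_add, hs, hs']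
  | tmul a b => simp [lapp_tmul]

end Tensor

namespace HaarPkg

variable (P : HaarPkg A)

lemma isPosElem_lapp_starT_mul_self (t : A ⊗[ℂ] A) :
    IsPosElem (lapp P.hHat (P.W.starT t * t)) := by
  obtain ⟨n, e, he⟩ := P.exists_hHat_reconstructing_family
  let β (i : Fin n) : A ⊗[ℂ] A →ₗ[ℂ] A := lapp (P.hHat ∘ₗ LinearMap.mulLeft ℂ (star (e i)))
  have h : ∀ s : A ⊗[ℂ] A, ∑ i, e i ⊗ₜ[ℂ] β i s = s := by
    intro s
    induction s with
    | zero => simp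
    | add s s' hs hs' =>
      simp only [map_add, TensorProduct.tmul_add, Finset.sum_add_distrib, hs, hs']
    | tmul a b =>
      conv_rhs => rw [← he a]
      simp [β, lapp_tmul, TensorProduct.sum_tmul, TensorProduct.smul_tmul]
  let starHom : A ⊗[ℂ] A →+ A ⊗[ℂ] A := AddMonoidHom.mk' P.W.starT P.W.starT_add
  have h' : P.W.starT t = ∑ i, star (e i) ⊗ₜ[ℂ] star (β i t) := by
    change starHom t = _
    conv_lhs => rw [← h t]
    rw [map_sum]
    exact Finset.sum_congr rfl fun i _ => P.W.starT_tmul _ _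
  rw [h', Finset.sum_mul, map_sum]
  refine isPosElem_sum _ _ fun i => ⟨β i t, ?_⟩
  rw [lapp_tmul_mul]

lemma isPosElem_jayEl : IsPosElem P.jayEl := by
  have h : star (Ring.inverse P.gL) = Ring.inverse P.gL := by
    rw [← Ring.inverse_star, P.gL_pos.star_eq]
  have h' := P.isPosElem_lapp_starT_mul_self (P.W.Δ (Ring.inverse P.gL))
  rwa [← P.W.Δ_star, ← P.W.Δ_mul, h] at h'

lemma hHat_εR'_mul (x : A) :
    P.hHat (P.W.εR' x * (Ring.inverse P.gL * Ring.inverse P.gL))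
      = P.hHat (P.W.εR x * (Ring.inverse P.gL * Ring.inverse P.gL)) := by
  obtain ⟨y, rfl⟩ := P.W.S.surjective x
  set c := Ring.inverse P.gL * Ring.inverse P.gL with hc
  have h4 : c * (P.gL * P.gR * P.g) = 1 := by
    rw [gL_mul_gR_mul_g, hc, mul_assoc, Ring.inverse_mul_cancel_left _ _ P.gL_unit,
      Ring.inverse_mul_cancel _ P.gL_unit]
  have h : ∀ t : A ⊗[ℂ] A,
      P.hHat (LinearMap.mul' ℂ A (TensorProduct.map P.W.S.toLinearMap LinearMap.id t) * c)
      = P.hHat (LinearMap.mul' ℂ A (TensorProduct.map P.W.S.toLinearMap LinearMap.id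
        (flipMap P.W.S.toLinearMap t)) * c) := by
    intro t
    induction t with
    | zero => simp
    | add s s' hs hs' => simp only [map_add, add_mul, hs, hs']
    | tmul p q =>
      have e : P.gL * P.gR * P.W.S (P.W.S q) * Ring.inverse (P.gL * P.gR)
          = P.gL * P.gR * P.g * (q * c) := by
        rw [P.S_sq, hc, ← P.ringInverse_g_mul]
        simp only [g, mul_assoc]
      simp only [flipMap_tmul, TensorProduct.map_tmul, LinearMap.mul'_apply, LinearEquiv.coe_coe,
        LinearMap.id_apply, mul_assoc (P.W.S (P.W.S q))]
      rw [← P.hHat_mul_modular (P.W.S (P.W.S q)), e, mul_assoc (P.W.S p) c, ← mul_assoc c, h4, one_mul, mul_assoc]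
  have h1 := h (P.W.Δ y)
  rw [P.W.flipMap_S_Δ] at h1
  rw [P.W.εR'_S]
  exact h1

lemma commute_jayEl (x : A) : Commute P.jayEl x := by
  change P.jayEl * x = x * P.jayEl
  set c := Ring.inverse P.gL * Ring.inverse P.gL with hc
  have e : P.jayEl = lapp (P.hHat ∘ₗ LinearMap.mulRight ℂ c) (P.W.Δ 1) := by
    rw [jayEl, (P.isLeft_gL.inverse.mul P.isLeft_gL.inverse).2, lapp_mul_tmul_one]
  have e' : (P.hHat ∘ₗ LinearMap.mulRight ℂ c) ∘ₗ P.W.εR'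
      = (P.hHat ∘ₗ LinearMap.mulRight ℂ c) ∘ₗ P.W.εR := LinearMap.ext P.hHat_εR'_mul
  rw [e, ← lapp_mul_one_tmul, ← lapp_one_tmul_mul, ← P.W.map_εR_Δ, ← P.W.map_εR'_Δ, lapp_map_id,
    lapp_map_id, e']

end HaarPkg

lemma commute_aeval_left {R : Type*} [Ring R] [Algebra ℝ R] {x y : R} (h : Commute x y) (p : Polynomial ℝ) :
    Commute (Polynomial.aeval x p) y := by
  have hx : x ∈ Subalgebra.centralizer ℝ {y} := by
    rw [Subalgebra.mem_centralizer_iff]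
    rintro z rfl
    exact h.symm.eq
  have hp := Algebra.adjoin_le (Set.singleton_subset_iff.2 hx)
    (Polynomial.aeval_mem_adjoin_singleton ℝ x (p := p))
  exact (Subalgebra.mem_centralizer_iff ℝ |>.1 hp y rfl).symm

lemma IsPosElem.commute_of_mul_self {x r : A} (hr : IsPosElem r) (hx : IsPosElem x)
    (h : r * r = x) {y : A} (hxy : Commute x y) : Commute r y := by
  obtain ⟨p, ⟨hp, hp'⟩, -⟩ := hx.exists_polynomial_sqrt hx
  rw [hr.eq_of_mul_self_eq hp (h.trans hp'.symm)]
  exact commute_aeval_left hxy p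

namespace WeakHopfData

variable (W : WeakHopfData A)

lemma S_aeval (x : A) (p : Polynomial ℝ) :
    W.S (Polynomial.aeval x p) = Polynomial.aeval (W.S x) p := by
  have h : ∀ n : ℕ, W.S (x ^ n) = W.S x ^ n := fun n => by
    induction n with
    | zero => simp [W.S_one]
    | succ n ih => rw [pow_succ, W.S_antimul, ih, pow_succ']
  induction p using Polynomial.induction_on' with
  | add p q hp hq => rw [map_add, map_add, map_add, hp, hq]
  | monomial n r =>
    rw [Polynomial.aeval_monomial, Polynomial.aeval_monomial, ← Algebra.smul_def,
      ← Algebra.smul_def, ← h]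
    exact W.S.map_smul (r : ℂ) (x ^ n)

end WeakHopfData

section FourLegs

section Join

variable {B : Type*} [NormedRing B] [NormedAlgebra ℂ B]

/-- The identification of `B^{⊗2} ⊗ B^{⊗2}` with `B^{⊗4}`. -/
def joinLegs : (B ⊗[ℂ] B) ⊗[ℂ] (B ⊗[ℂ] B) →ₗ[ℂ] ((B ⊗[ℂ] B) ⊗[ℂ] B) ⊗[ℂ] B :=
  (TensorProduct.assoc ℂ (B ⊗[ℂ] B) B B).symm.toLinearMap

lemma joinLegs_mul (s t : (B ⊗[ℂ] B) ⊗[ℂ] (B ⊗[ℂ] B)) :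
    joinLegs (s * t) = joinLegs s * joinLegs t :=
  map_mul (Algebra.TensorProduct.assoc ℂ ℂ ℂ (B ⊗[ℂ] B) B B).symm s t

lemma firstTwoLegs_eq (t : B ⊗[ℂ] B) : firstTwoLegs t = joinLegs (t ⊗ₜ[ℂ] (1 : B ⊗[ℂ] B)) := rfl

lemma lastTwoLegs_eq (t : B ⊗[ℂ] B) : lastTwoLegs t = joinLegs ((1 : B ⊗[ℂ] B) ⊗ₜ[ℂ] t) := by
  induction t with
  | zero => simp
  | add s s' hs hs' => simp only [map_add, TensorProduct.tmul_add, hs, hs']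
  | tmul a b => rfl

lemma commute_tmul_self {k : B} (hk : ∀ x, Commute k x) (t : B ⊗[ℂ] B) :
    Commute (k ⊗ₜ[ℂ] k) t := by
  induction t with
  | zero => exact Commute.zero_right _
  | add s s' hs hs' => exact hs.add_right hs'
  | tmul a b =>
    change _ * _ = _ * _
    rw [Algebra.TensorProduct.tmul_mul_tmul, Algebra.TensorProduct.tmul_mul_tmul, (hk a).eq,
      (hk b).eq]

end Join

lemma WeakHopfData.Δ3_eq (W : WeakHopfData A) (x : A) :
    W.Δ3 x = joinLegs (TensorProduct.map W.Δ W.Δ (W.Δ x)) := by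
  have h1 : ∀ t : A ⊗[ℂ] A, TensorProduct.map W.Δ2 LinearMap.id t
      = TensorProduct.map (TensorProduct.map W.Δ LinearMap.id) LinearMap.id
        (TensorProduct.map W.Δ LinearMap.id t) := by
    intro t
    induction t with
    | zero => simp
    | add s s' hs hs' => simp only [map_add, hs, hs']
    | tmul a b => rfl
  have h2 : ∀ a (t : A ⊗[ℂ] A), TensorProduct.map (TensorProduct.map W.Δ LinearMap.id)
      LinearMap.id ((TensorProduct.assoc ℂ A A A).symm (a ⊗ₜ[ℂ] t)) = joinLegs (W.Δ a ⊗ₜ[ℂ] t) := by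
    intro a t
    induction t with
    | zero => simp
    | add s s' hs hs' => simp only [map_add, TensorProduct.tmul_add, hs, hs']
    | tmul b c => rfl
  have h3 : ∀ t : A ⊗[ℂ] A, TensorProduct.map (TensorProduct.map W.Δ LinearMap.id)
      LinearMap.id ((TensorProduct.assoc ℂ A A A).symm (TensorProduct.map LinearMap.id W.Δ t))
      = joinLegs (TensorProduct.map W.Δ W.Δ t) := by
    intro t
    induction t with
    | zero => simp
    | add s s' hs hs' => simp only [map_add, hs, hs']
    | tmul a b => exact h2 a (W.Δ b)
  rw [← h3, ← coassoc_apply, LinearEquiv.symm_apply_apply, ← h1]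
  rfl

lemma WeakHopfData.tmul_one_mul_map_Δ_integral (W : WeakHopfData A) {h : A}
    (hh : ∀ x : A, h * x = h * W.εR x) {k q : A ⊗[ℂ] A} (hk : ∀ x, Commute k (W.Δ x)) (x : A) :
    W.Δ x ⊗ₜ[ℂ] (1 : A ⊗[ℂ] A) * TensorProduct.map (LinearMap.mulLeft ℂ k ∘ₗ
        LinearMap.mulRight ℂ q ∘ₗ W.Δ ∘ₗ W.S.toLinearMap) W.Δ (W.Δ h)
      = TensorProduct.map (LinearMap.mulLeft ℂ k ∘ₗ
        LinearMap.mulRight ℂ q ∘ₗ W.Δ ∘ₗ W.S.toLinearMap) W.Δ (W.Δ h)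
        * (1 : A ⊗[ℂ] A) ⊗ₜ[ℂ] W.Δ x := by
  obtain ⟨z, rfl⟩ := W.S.surjective x
  set G := LinearMap.mulLeft ℂ k ∘ₗ LinearMap.mulRight ℂ q ∘ₗ W.Δ ∘ₗ W.S.toLinearMap with hG
  have h1 : ∀ t, W.Δ (W.S z) ⊗ₜ[ℂ] (1 : A ⊗[ℂ] A) * TensorProduct.map G W.Δ t
      = TensorProduct.map G W.Δ (t * z ⊗ₜ[ℂ] (1 : A)) := by
    intro t
    induction t with
    | zero => simp
    | add s s' hs hs' => simp only [map_add, add_mul, mul_add, hs, hs']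
    | tmul a b =>
      simp only [Algebra.TensorProduct.tmul_mul_tmul, TensorProduct.map_tmul, mul_one, one_mul, hG,
        LinearMap.comp_apply, LinearMap.mulLeft_apply, LinearMap.mulRight_apply,
        LinearEquiv.coe_coe, W.S_antimul, W.Δ_mul, ← mul_assoc, (hk (W.S z)).eq]
  have h2 : ∀ t, TensorProduct.map G W.Δ t * (1 : A ⊗[ℂ] A) ⊗ₜ[ℂ] W.Δ (W.S z)
      = TensorProduct.map G W.Δ (t * (1 : A) ⊗ₜ[ℂ] W.S z) := by
    intro t
    induction t with
    | zero => simp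
    | add s s' hs hs' => simp only [map_add, add_mul, hs, hs']
    | tmul a b => simp [W.Δ_mul]
  rw [h1, h2, W.Δ_integral_mul_tmul_one hh]

end FourLegs

namespace HaarPkg

variable (P : HaarPkg A)

/-- The positive square root of `ı^{1/2} ȷ^{1/2}` is central. -/
lemma exists_central_sqrt : ∃ k : A, IsPosElem k ∧ (∀ x, Commute k x) ∧
    k * k = P.sqrt P.iotaEl * P.sqrt P.jayEl := by
  have hi : ∀ x, Commute (P.sqrt P.iotaEl) x := fun x =>
    (P.sqrt_pos _ P.isPosElem_iotaEl).commute_of_mul_self P.isPosElem_iotaEl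
      (P.sqrt_mul_self _ P.isPosElem_iotaEl) (P.commute_iotaEl x)
  have hj : ∀ x, Commute (P.sqrt P.jayEl) x := fun x =>
    (P.sqrt_pos _ P.isPosElem_jayEl).commute_of_mul_self P.isPosElem_jayEl
      (P.sqrt_mul_self _ P.isPosElem_jayEl) (P.commute_jayEl x)
  have hpos : IsPosElem (P.sqrt P.iotaEl * P.sqrt P.jayEl) :=
    (P.sqrt_pos _ P.isPosElem_iotaEl).mul_of_commute (P.sqrt_pos _ P.isPosElem_jayEl) (hi _)
  exact ⟨_, P.sqrt_pos _ hpos, fun x => (P.sqrt_pos _ hpos).commute_of_mul_self hpos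
    (P.sqrt_mul_self _ hpos) ((hi x).mul_left (hj x)), P.sqrt_mul_self _ hpos⟩

/-- The two legs multiplying `Δ(S(Ω₍₁₎))` in the four-leg tensor. -/
lemma exists_central_legs : ∃ k : A, (∀ x, Commute k x) ∧
    (P.sqrt P.ξL * Ring.inverse (P.sqrt P.g)) ⊗ₜ[ℂ] (P.sqrt P.ξR * Ring.inverse (P.sqrt P.g))
      * P.W.Δ (Ring.inverse P.gR) = k ⊗ₜ[ℂ] k * P.W.Δ 1 := by
  obtain ⟨k, hk, hkc, hkk⟩ := P.exists_central_sqrt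
  obtain ⟨p, ⟨hu, huu⟩, hv, hvv⟩ := P.gL_pos.exists_polynomial_sqrt P.gR_pos
  have hul : P.W.IsLeft (Polynomial.aeval P.gL p) := P.isLeft_gL.aeval p
  have hSu : P.W.S (Polynomial.aeval P.gL p) = Polynomial.aeval P.gR p := by
    rw [P.W.S_aeval, ← P.gR_S]
  have huv : Commute (Polynomial.aeval P.gL p) (Polynomial.aeval P.gR p) :=
    commute_aeval_left (commute_aeval_left P.gLR_comm.symm p).symm p
  have huR : Commute (Polynomial.aeval P.gL p) P.gR := commute_aeval_left P.gLR_comm p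
  set u := Polynomial.aeval P.gL p
  set v := Polynomial.aeval P.gR p
  have huU : IsUnit u := ((Commute.refl u).isUnit_mul_iff.1 (huu ▸ P.gL_unit)).1
  have hvU : IsUnit v := ((Commute.refl v).isUnit_mul_iff.1 (hvv ▸ P.gR_unit)).1
  have hsq : ∀ w x : A, IsPosElem w → IsPosElem x → w * w = x →
      P.sqrt (P.sqrt P.iotaEl * P.sqrt P.jayEl * x) = k * w := by
    intro w x hw hx hwx
    have hs : (k * w) * (k * w) = P.sqrt P.iotaEl * P.sqrt P.jayEl * x := by
      rw [← hkk, ← hwx, (hkc w).mul_mul_mul_comm]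
    have hp : IsPosElem (P.sqrt P.iotaEl * P.sqrt P.jayEl * x) := by
      rw [← hkk]
      exact (hk.mul_of_commute hk rfl).mul_of_commute hx ((hkc x).mul_left (hkc x))
    exact (P.sqrt_pos _ hp).eq_of_mul_self_eq (hk.mul_of_commute hw (hkc w))
      ((P.sqrt_mul_self _ hp).trans hs.symm)
  have hξL : P.sqrt P.ξL = k * u := hsq u _ hu P.gL_pos huu
  have hξR : P.sqrt P.ξR = k * v := hsq v _ hv P.gR_pos hvv
  have hvi : IsPosElem (Ring.inverse v) := by
    obtain ⟨v', hv'⟩ := hvU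
    rw [← hv', Ring.inverse_unit]
    exact IsPosElem.units_inv (hv' ▸ hv)
  have hg : P.sqrt P.g = u * Ring.inverse v := by
    have hui : Commute u (Ring.inverse v) := commute_ringInverse_right huv
    refine (P.sqrt_pos _ P.g_pos).eq_of_mul_self_eq (hu.mul_of_commute hvi hui)
      ((P.sqrt_mul_self _ P.g_pos).trans ?_)
    rw [hui.symm.mul_mul_mul_comm, huu, ← Ring.inverse_mul (Or.inl hvU), hvv]
  have hgi : Ring.inverse (P.sqrt P.g) = v * Ring.inverse u := by
    rw [hg, Ring.inverse_mul (Or.inl huU), Ring.inverse_inverse hvU]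
  have h1 : k * u * (v * Ring.inverse u) = k * v := by
    rw [← mul_assoc, mul_assoc k, huv.eq, ← mul_assoc, Ring.mul_inverse_cancel_right _ _ huU]
  have h2 : k * v * (v * Ring.inverse u) * Ring.inverse P.gR = k * Ring.inverse u := by
    rw [mul_assoc k, ← mul_assoc v, hvv, (commute_ringInverse_right huR.symm).eq, ← mul_assoc,
      Ring.mul_inverse_cancel_right _ _ P.gR_unit]
  have hb : P.W.IsRight (Ring.inverse P.gR) := P.S_ringInverse_gL ▸ P.isLeft_gL.inverse.map_S
  have h3 : (k * v) ⊗ₜ[ℂ] (k * Ring.inverse u)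
      = k ⊗ₜ[ℂ] (k * Ring.inverse u) * v ⊗ₜ[ℂ] (1 : A) := by simp
  refine ⟨k, hkc, ?_⟩
  rw [hξL, hξR, hgi, hb.1, ← mul_assoc, Algebra.TensorProduct.tmul_mul_tmul, mul_one, h1, h2, h3,
    mul_assoc, ← hSu, ← hul.one_tmul_mul_Δ_one, ← mul_assoc, Algebra.TensorProduct.tmul_mul_tmul,
    mul_one, Ring.inverse_mul_cancel_right _ _ huU]

lemma Δ_Ω : P.W.Δ P.Ω = (Ring.inverse P.iotaEl * Ring.inverse P.gL) ⊗ₜ[ℂ] (1 : A) * P.W.Δ P.h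
    * Ring.inverse P.gL ⊗ₜ[ℂ] (1 : A) := by
  have hl : P.W.IsLeft (Ring.inverse P.iotaEl * Ring.inverse P.gL) :=
    (P.W.isLeft_εL _).inverse.mul P.isLeft_gL.inverse
  rw [Ω, P.W.Δ_mul, P.W.Δ_mul, hl.1, P.isLeft_gL.inverse.2, mul_assoc _ (P.W.Δ 1), P.W.Δ_one_mul,
    ← mul_assoc, mul_assoc _ (P.W.Δ P.h), P.W.Δ_mul_one]

lemma exists_fourLegTensor_eq : ∃ (k : A) (q : A ⊗[ℂ] A), (∀ x, Commute k x) ∧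
    P.fourLegTensor = joinLegs (TensorProduct.map (LinearMap.mulLeft ℂ (k ⊗ₜ[ℂ] k) ∘ₗ
      LinearMap.mulRight ℂ q ∘ₗ P.W.Δ ∘ₗ P.W.S.toLinearMap) P.W.Δ (P.W.Δ P.h)) := by
  obtain ⟨k, hk, hX⟩ := P.exists_central_legs
  set X := (P.sqrt P.ξL * Ring.inverse (P.sqrt P.g)) ⊗ₜ[ℂ]
    (P.sqrt P.ξR * Ring.inverse (P.sqrt P.g)) with hXdef
  set r := P.sqrt P.g ⊗ₜ[ℂ] P.sqrt P.g with hr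
  set l := Ring.inverse P.iotaEl * Ring.inverse P.gL with hl
  let N : A ⊗[ℂ] A →ₗ[ℂ] A ⊗[ℂ] A :=
    TensorProduct.map (LinearMap.mulLeft ℂ (P.sqrt P.ξL) ∘ₗ P.Jlin)
      (LinearMap.mulLeft ℂ (P.sqrt P.ξR) ∘ₗ P.Jlin) ∘ₗ (TensorProduct.comm ℂ A A).toLinearMap
  have hN : ∀ t, N t = X * flipMap P.W.S.toLinearMap t * r := by
    intro t
    induction t with
    | zero => simp
    | add s s' hs hs' => simp only [map_add, add_mul, mul_add, hs, hs']
    | tmul a b => simp [N, flipMap_tmul, Jlin, hXdef, hr, mul_assoc]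
  have hjoin : ∀ t : (A ⊗[ℂ] A) ⊗[ℂ] (A ⊗[ℂ] A),
      TensorProduct.map (TensorProduct.map N LinearMap.id) LinearMap.id (joinLegs t)
      = joinLegs (TensorProduct.map N LinearMap.id t) := by
    intro t
    induction t with
    | zero => simp
    | add s s' hs hs' => simp only [map_add, hs, hs']
    | tmul s t =>
      induction t with
      | zero => simp
      | add s s' hs hs' => simp only [map_add, TensorProduct.tmul_add, hs, hs']
      | tmul a b => rfl
  have hΔ : ∀ t : A ⊗[ℂ] A, TensorProduct.map N LinearMap.id (TensorProduct.map P.W.Δ P.W.Δ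
      (l ⊗ₜ[ℂ] (1 : A) * t * Ring.inverse P.gL ⊗ₜ[ℂ] (1 : A)))
      = TensorProduct.map (LinearMap.mulLeft ℂ (k ⊗ₜ[ℂ] k) ∘ₗ
      LinearMap.mulRight ℂ (P.W.Δ (P.W.S l) * r) ∘ₗ P.W.Δ ∘ₗ P.W.S.toLinearMap) P.W.Δ t := by
    intro t
    induction t with
    | zero => simp
    | add s s' hs hs' => simp only [map_add, add_mul, mul_add, hs, hs']
    | tmul a b =>
      simp only [Algebra.TensorProduct.tmul_mul_tmul, TensorProduct.map_tmul, one_mul, mul_one,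
        LinearMap.id_apply, hN, P.W.flipMap_S_Δ, P.W.S_antimul, S_ringInverse_gL,
        LinearMap.comp_apply, LinearMap.mulLeft_apply, LinearMap.mulRight_apply,
        LinearEquiv.coe_coe]
      rw [P.W.Δ_mul, P.W.Δ_mul, ← mul_assoc X, hX, mul_assoc _ (P.W.Δ 1), ← mul_assoc (P.W.Δ 1), P.W.Δ_one_mul]
      simp only [mul_assoc]
  refine ⟨k, P.W.Δ (P.W.S l) * r, hk, ?_⟩
  rw [← hΔ, ← P.Δ_Ω, ← hjoin, ← P.W.Δ3_eq]
  rfl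

end HaarPkg

/-- **The four-leg pulling-through identity.**  For all `x ∈ A`, in `A^{⊗4}`:
`x₍₁₎ ξ_L^{1/2} J(Ω₍₂₎) ⊗ x₍₂₎ ξ_R^{1/2} J(Ω₍₁₎) ⊗ Ω₍₃₎ ⊗ Ω₍₄₎`
`= ξ_L^{1/2} J(Ω₍₂₎) ⊗ ξ_R^{1/2} J(Ω₍₁₎) ⊗ Ω₍₃₎ x₍₁₎ ⊗ Ω₍₄₎ x₍₂₎`. -/
theorem HaarPkg.four_leg_pulling_through (P : HaarPkg A) (x : A) :
    firstTwoLegs (P.W.Δ x) * P.fourLegTensor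
      = P.fourLegTensor * lastTwoLegs (P.W.Δ x) := by
  obtain ⟨k, q, hk, h⟩ := P.exists_fourLegTensor_eq
  rw [h, firstTwoLegs_eq, lastTwoLegs_eq, ← joinLegs_mul, ← joinLegs_mul,
    P.W.tmul_one_mul_map_Δ_integral P.haar_right fun x => commute_tmul_self hk (P.W.Δ x)]

end Stmt19

end
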